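/- Spectral bound for the linearized operator 𝓛 − αΓ on Gaussian-weighted spaces. Let α ≠ 0 and let 𝓛 = Δ_ξ + (1/2)ξ·∇_ξ + 1 and Γf = g·∇_ξ f − f·∇_ξ g act on ℝ²-valued functions on ℝ², where g(ξ) = (1/(2π))(ξ^⊥/|ξ|²)(1−e^{−|ξ|²/4}). Then there exists μ = μ(α) ∈ (0, 1/2] such that: if f : ℝ² → ℂ² is smooth with ξ^k ∇_ξ^ℓ f ∈ L²_ξ(∞) for all integers k, ℓ ≥ 0, f ≠ 0, and (𝓛 − αΓ)f = λf for some λ ∈ ℂ, then Re λ ≤ −μ. -/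

import Mathlib

/-!
Spectral bound for the linearized operator `𝓛 − αΓ` on Gaussian-weighted
spaces: for `α ≠ 0` there is `μ = μ(α) ∈ (0,1/2]` such that every eigenvalue
`λ` of `𝓛 − αΓ` with eigenfunction having Gaussian decay satisfies `Re λ ≤ −μ`.
-/

open MeasureTheory Real
open scoped ENNReal

noncomputable section

abbrev R2 : Type := EuclideanSpace ℝ (Fin 2)
abbrev C2 : Type := EuclideanSpace ℂ (Fin 2)

def v2 (a b : ℝ) : R2 := (WithLp.equiv 2 (Fin 2 → ℝ)).symm ![a, b]
def cv2 (a b : ℂ) : C2 := (WithLp.equiv 2 (Fin 2 → ℂ)).symm ![a, b]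
def e2 (i : Fin 2) : R2 := EuclideanSpace.single i 1

/-- the 2d Oseen velocity profile `g(ξ) = (1/2π)(ξ^⊥/|ξ|²)(1−e^{−|ξ|²/4})`. -/
def gvec (ξ : R2) : R2 :=
  ((2 * π)⁻¹ * ‖ξ‖^(-(2:ℝ)) * (1 - Real.exp (-‖ξ‖^2/4))) • v2 (-(ξ 1)) (ξ 0)

/-- the Fokker–Planck operator `𝓛 = Δ + (1/2)ξ·∇ + 1` on ℂ²-valued functions. -/
def FP (f : R2 → C2) (ξ : R2) : C2 :=
  (∑ i : Fin 2, fderiv ℝ (fun w => fderiv ℝ f w (e2 i)) ξ (e2 i))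
    + (1/2 : ℝ) • fderiv ℝ f ξ ξ + f ξ

/-- `Γ f = g·∇f − f·∇g`. -/
def GammaOp (f : R2 → C2) (ξ : R2) : C2 :=
  fderiv ℝ f ξ (gvec ξ) -
    cv2 (f ξ 0 * ((fderiv ℝ gvec ξ (e2 0)) 0 : ℝ) + f ξ 1 * ((fderiv ℝ gvec ξ (e2 1)) 0 : ℝ))
        (f ξ 0 * ((fderiv ℝ gvec ξ (e2 0)) 1 : ℝ) + f ξ 1 * ((fderiv ℝ gvec ξ (e2 1)) 1 : ℝ))

/-- Gaussian decay of `f` and all its polynomially weighted derivatives: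
`ξ^k ∇^ℓ f ∈ L²_ξ(∞)` for all `k, ℓ`. -/
def GaussianDecay (f : R2 → C2) : Prop :=
  ∀ k l : ℕ,
    (∫⁻ ξ : R2, ENNReal.ofReal
      (‖ξ‖^(2*k) * ‖iteratedFDeriv ℝ l f ξ‖^2 * Real.exp (‖ξ‖^2/4))) < ⊤

section

open Set Filter Topology ComplexConjugate

section HalfLine

theorem integral_Ioi_zero_of_hasDerivAt {E : Type*} [NormedAddCommGroup E] [NormedSpace ℝ E]
    [CompleteSpace E] {F F' : ℝ → E} (hd : ∀ r, 0 < r → HasDerivAt F (F' r) r)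
    (hF : IntegrableOn F (Ioi 0)) (hF' : IntegrableOn F' (Ioi 0))
    (h0 : Tendsto F (𝓝[>] 0) (𝓝 0)) : ∫ r in Ioi (0 : ℝ), F' r = 0 := by
  have hlim := tendsto_zero_of_hasDerivAt_of_integrableOn_Ioi (a := 0) (fun r hr => hd r hr) hF' hF
  have hne : ∀ r : ℝ, 0 < r → Function.update F 0 0 =ᶠ[𝓝 r] F := fun r hr => by
    filter_upwards [eventually_ne_nhds hr.ne'] with x hx
    exact Function.update_of_ne hx _ _
  have hc : ContinuousWithinAt (Function.update F 0 0) (Ici 0) 0 := by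
    rw [continuousWithinAt_update_same]
    simpa using h0
  have key := integral_Ioi_of_hasDerivAt_of_tendsto (m := (0 : E)) hc
    (fun r hr => (hd r hr).congr_of_eventuallyEq (hne r hr)) hF' (hlim.congr' (by
      filter_upwards [eventually_ne_atTop 0] with x hx
      exact (Function.update_of_ne hx _ _).symm))
  simpa using key

/-- A first order form of the radial equation for an angular mode, with the integrability and the
behaviour at the origin needed for the energy identities. -/
structure RadialSystem (M : ℝ) (Λ y S : ℝ → ℂ) : Prop where
  deriv_y : ∀ r : ℝ, 0 < r → HasDerivAt y (S r - ((r / 2 - M / r : ℝ) : ℂ) * y r) r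
  deriv_S : ∀ r : ℝ, 0 < r → HasDerivAt S (-(((1 + M) / r : ℝ) : ℂ) * S r + Λ r * y r) r
  int_y : IntegrableOn (fun r => r * exp (r ^ 2 / 4) * ‖y r‖ ^ 2) (Ioi 0)
  int_S : IntegrableOn (fun r => r * exp (r ^ 2 / 4) * ‖S r‖ ^ 2) (Ioi 0)
  lim_y : Tendsto (fun r => r * ‖y r‖ ^ 2) (𝓝[>] 0) (𝓝 0)
  lim_S : Tendsto (fun r => r * (‖S r‖ * ‖y r‖)) (𝓝[>] 0) (𝓝 0)

namespace RadialSystem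

variable {M : ℝ} {Λ y S : ℝ → ℂ}

theorem continuousOn_y (h : RadialSystem M Λ y S) : ContinuousOn y (Ioi 0) :=
  fun r hr => (h.deriv_y r hr).continuousAt.continuousWithinAt

theorem continuousOn_S (h : RadialSystem M Λ y S) : ContinuousOn S (Ioi 0) :=
  fun r hr => (h.deriv_S r hr).continuousAt.continuousWithinAt

theorem integrableOn_of_le (h : RadialSystem M Λ y S) {E : Type*} [NormedAddCommGroup E]
    [NormedSpace ℝ E] {F : ℝ → E} (hc : ContinuousOn F (Ioi 0)) (C : ℝ)
    (hb : ∀ r : ℝ, 0 < r → ‖F r‖ ≤ C * (r * exp (r ^ 2 / 4) * (‖y r‖ ^ 2 + ‖S r‖ ^ 2))) :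
    IntegrableOn F (Ioi 0) := by
  have hi : IntegrableOn (fun r => C * (r * exp (r ^ 2 / 4) * (‖y r‖ ^ 2 + ‖S r‖ ^ 2)))
      (Ioi 0) := by
    have := (h.int_y.add h.int_S).const_mul C
    refine this.congr (Eventually.of_forall fun r => ?_)
    simp only [Pi.add_apply]
    ring
  refine Integrable.mono' hi (hc.aestronglyMeasurable measurableSet_Ioi) ?_
  filter_upwards [ae_restrict_mem measurableSet_Ioi] with r hr using hb r hr

theorem energy_identity (h : RadialSystem M Λ y S) (hΛ : ContinuousOn Λ (Ioi 0)) {L : ℝ}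
    (hL : ∀ r : ℝ, 0 < r → ‖Λ r‖ ≤ L) {η η' : ℝ → ℝ} (hη : ∀ r : ℝ, 0 < r → HasDerivAt η (η' r) r)
    (hη' : ContinuousOn η' (Ioi 0)) {B : ℝ} (hB : ∀ r : ℝ, 0 < r → |η r| ≤ B)
    (hB' : ∀ r : ℝ, 0 < r → |η' r| ≤ B) :
    IntegrableOn (fun r => ((r * exp (r ^ 2 / 4) : ℝ) : ℂ) *
      (Λ r * ((‖y r‖ ^ 2 : ℝ) : ℂ) * η r + ((‖S r‖ ^ 2 : ℝ) : ℂ) * η r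
        + S r * conj (y r) * η' r)) (Ioi 0) ∧
    ∫ r in Ioi (0 : ℝ), ((r * exp (r ^ 2 / 4) : ℝ) : ℂ) *
      (Λ r * ((‖y r‖ ^ 2 : ℝ) : ℂ) * η r + ((‖S r‖ ^ 2 : ℝ) : ℂ) * η r
        + S r * conj (y r) * η' r) = 0 := by
  have cy := h.continuousOn_y
  have cS := h.continuousOn_S
  have cη : ContinuousOn η (Ioi 0) := fun r hr => (hη r hr).continuousAt.continuousWithinAt
  have hB0 : 0 ≤ B := (abs_nonneg _).trans (hB 1 one_pos)
  have hL0 : 0 ≤ L := (norm_nonneg _).trans (hL 1 one_pos)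
  set F' : ℝ → ℂ := fun r => ((r * exp (r ^ 2 / 4) : ℝ) : ℂ) *
      (Λ r * ((‖y r‖ ^ 2 : ℝ) : ℂ) * η r + ((‖S r‖ ^ 2 : ℝ) : ℂ) * η r
        + S r * conj (y r) * η' r) with hF'def
  let F : ℝ → ℂ := fun r => ((r * exp (r ^ 2 / 4) : ℝ) : ℂ) * (S r * conj (y r)) * η r
  have hd : ∀ r : ℝ, 0 < r → HasDerivAt F (F' r) r := by
    intro r hr
    have e1 : HasDerivAt (fun r : ℝ => r * exp (r ^ 2 / 4))
        (exp (r ^ 2 / 4) + r * (exp (r ^ 2 / 4) * (r / 2))) r := by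
      have := (hasDerivAt_id' r).mul (((hasDerivAt_pow 2 r).div_const 4).exp)
      refine this.congr_deriv ?_
      push_cast
      ring
    have e2 := (h.deriv_S r hr).mul (h.deriv_y r hr).star
    have e3 := (e1.ofReal_comp.mul e2).mul (hη r hr).ofReal_comp
    have hr' : (r : ℂ) ≠ 0 := by exact_mod_cast hr.ne'
    have n1 : ((‖y r‖ ^ 2 : ℝ) : ℂ) = y r * conj (y r) := by
      rw [Complex.mul_conj', Complex.ofReal_pow]
    have n2 : ((‖S r‖ ^ 2 : ℝ) : ℂ) = S r * conj (S r) := by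
      rw [Complex.mul_conj', Complex.ofReal_pow]
    refine e3.congr_deriv ?_
    simp only [hF'def, n1, n2, Pi.mul_apply, Complex.star_def, map_sub, map_mul,
      Complex.conj_ofReal]
    push_cast
    field_simp
    ring
  have hyS : ∀ r, ‖S r‖ * ‖y r‖ ≤ ‖y r‖ ^ 2 + ‖S r‖ ^ 2 := fun r => by
    nlinarith [sq_nonneg (‖S r‖ - ‖y r‖), sq_nonneg ‖S r‖, sq_nonneg ‖y r‖]
  have hw : ∀ r : ℝ, 0 < r → 0 ≤ r * exp (r ^ 2 / 4) := fun r hr => by positivity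
  have iF : IntegrableOn F (Ioi 0) := by
    refine h.integrableOn_of_le (fun r hr => (hd r hr).continuousAt.continuousWithinAt) B ?_
    intro r hr
    simp only [F, norm_mul, RCLike.norm_conj, Complex.norm_real, norm_eq_abs (η r)]
    rw [norm_of_nonneg hr.le, norm_of_nonneg (exp_nonneg _)]
    calc _ ≤ r * exp (r ^ 2 / 4) * (‖y r‖ ^ 2 + ‖S r‖ ^ 2) * B := by
          gcongr
          · exact hyS r
          · exact hB r hr
      _ = _ := by ring
  have iF' : IntegrableOn F' (Ioi 0) := by
    refine h.integrableOn_of_le (by fun_prop) (L * B + B + B) ?_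
    intro r hr
    have b1 : ‖Λ r * ((‖y r‖ ^ 2 : ℝ) : ℂ) * η r‖ ≤ L * (‖y r‖ ^ 2 + ‖S r‖ ^ 2) * B := by
      simp only [norm_mul, Complex.norm_real, norm_eq_abs (η r), norm_of_nonneg (sq_nonneg _)]
      gcongr
      · exact hL r hr
      · exact le_add_of_nonneg_right (sq_nonneg _)
      · exact hB r hr
    have b2 : ‖((‖S r‖ ^ 2 : ℝ) : ℂ) * η r‖ ≤ (‖y r‖ ^ 2 + ‖S r‖ ^ 2) * B := by
      simp only [norm_mul, Complex.norm_real, norm_eq_abs (η r), norm_of_nonneg (sq_nonneg _)]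
      gcongr
      · exact le_add_of_nonneg_left (sq_nonneg _)
      · exact hB r hr
    have b3 : ‖S r * conj (y r) * η' r‖ ≤ (‖y r‖ ^ 2 + ‖S r‖ ^ 2) * B := by
      simp only [norm_mul, RCLike.norm_conj, Complex.norm_real, norm_eq_abs (η' r)]
      gcongr
      · exact hyS r
      · exact hB' r hr
    simp only [hF'def]
    rw [norm_mul, Complex.norm_real, norm_of_nonneg (hw r hr)]
    calc _ ≤ r * exp (r ^ 2 / 4) * (L * (‖y r‖ ^ 2 + ‖S r‖ ^ 2) * B
            + (‖y r‖ ^ 2 + ‖S r‖ ^ 2) * B + (‖y r‖ ^ 2 + ‖S r‖ ^ 2) * B) := by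
          gcongr
          exact (norm_add₃_le).trans (add_le_add_three b1 b2 b3)
      _ = _ := by ring
  refine ⟨iF', integral_Ioi_zero_of_hasDerivAt hd iF iF' ?_⟩
  have hexp : Tendsto (fun r : ℝ => exp (r ^ 2 / 4) * B) (𝓝[>] 0) (𝓝 (exp (0 ^ 2 / 4) * B)) :=
    ((by fun_prop : Continuous fun r : ℝ => exp (r ^ 2 / 4) * B).tendsto 0).mono_left
      nhdsWithin_le_nhds
  have hz := h.lim_S.mul hexp
  rw [zero_mul] at hz
  refine squeeze_zero_norm' ?_ hz
  filter_upwards [self_mem_nhdsWithin] with r hr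
  simp only [F, norm_mul, RCLike.norm_conj, Complex.norm_real, norm_eq_abs (η r)]
  rw [norm_of_nonneg (le_of_lt hr), norm_of_nonneg (exp_nonneg _)]
  calc _ ≤ r * exp (r ^ 2 / 4) * (‖S r‖ * ‖y r‖) * B := by
        have : (0 : ℝ) < r := hr
        gcongr
        · exact hB r hr
    _ = _ := by ring

theorem weight_identity (h : RadialSystem 1 Λ y S) {ζ ζ' : ℝ → ℝ}
    (hζ : ∀ r : ℝ, 0 < r → HasDerivAt ζ (ζ' r) r) (hζ' : ContinuousOn ζ' (Ioi 0)) {B : ℝ}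
    (hB : ∀ r : ℝ, 0 < r → |r * ζ r| ≤ B)
    (hB' : ∀ r : ℝ, 0 < r → |4 * ζ r + r * ζ' r - r ^ 2 * ζ r / 2| ≤ B) :
    IntegrableOn (fun r => r * exp (r ^ 2 / 4) *
      ((4 * ζ r + r * ζ' r - r ^ 2 * ζ r / 2) * ‖y r‖ ^ 2
        + 2 * (r * ζ r) * (S r * conj (y r)).re)) (Ioi 0) ∧
    ∫ r in Ioi (0 : ℝ), r * exp (r ^ 2 / 4) *
      ((4 * ζ r + r * ζ' r - r ^ 2 * ζ r / 2) * ‖y r‖ ^ 2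
        + 2 * (r * ζ r) * (S r * conj (y r)).re) = 0 := by
  have cy := h.continuousOn_y
  have cS := h.continuousOn_S
  have cζ : ContinuousOn ζ (Ioi 0) := fun r hr => (hζ r hr).continuousAt.continuousWithinAt
  set F' : ℝ → ℝ := fun r => r * exp (r ^ 2 / 4) *
      ((4 * ζ r + r * ζ' r - r ^ 2 * ζ r / 2) * ‖y r‖ ^ 2
        + 2 * (r * ζ r) * (S r * conj (y r)).re) with hF'def
  let F : ℝ → ℝ := fun r => r ^ 2 * exp (r ^ 2 / 4) * ‖y r‖ ^ 2 * ζ r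
  have hw : ∀ r : ℝ, 0 < r → 0 ≤ r * exp (r ^ 2 / 4) := fun r hr => by positivity
  have hB0 : 0 ≤ B := (abs_nonneg _).trans (hB 1 one_pos)
  have hd : ∀ r : ℝ, 0 < r → HasDerivAt F (F' r) r := by
    intro r hr
    have e1 : HasDerivAt (fun r : ℝ => r ^ 2 * exp (r ^ 2 / 4))
        (2 * r * exp (r ^ 2 / 4) + r ^ 2 * (exp (r ^ 2 / 4) * (r / 2))) r := by
      have := (hasDerivAt_pow 2 r).mul (((hasDerivAt_pow 2 r).div_const 4).exp)
      refine this.congr_deriv ?_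
      push_cast
      ring
    have e3 := (e1.mul (h.deriv_y r hr).norm_sq).mul (hζ r hr)
    refine e3.congr_deriv ?_
    have hin : inner ℝ (y r) (S r - ((r / 2 - 1 / r : ℝ) : ℂ) * y r)
        = (S r * conj (y r)).re - (r / 2 - 1 / r) * ‖y r‖ ^ 2 := by
      rw [inner_sub_right, Complex.inner, Complex.inner, ← Complex.normSq_eq_norm_sq,
        mul_assoc, Complex.mul_conj, Complex.re_ofReal_mul, Complex.ofReal_re]
    simp only [hF'def, hin, Pi.mul_apply]
    field_simp
    ring
  have hre : ∀ r, |(S r * conj (y r)).re| ≤ ‖S r‖ * ‖y r‖ := fun r => by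
    simpa using Complex.abs_re_le_norm (S r * conj (y r))
  have iF : IntegrableOn F (Ioi 0) := by
    refine h.integrableOn_of_le (fun r hr => (hd r hr).continuousAt.continuousWithinAt) B ?_
    intro r hr
    have : F r = r * exp (r ^ 2 / 4) * ‖y r‖ ^ 2 * (r * ζ r) := by simp only [F]; ring
    rw [this, norm_mul, norm_of_nonneg (mul_nonneg (hw r hr) (sq_nonneg _)), norm_eq_abs]
    calc _ ≤ r * exp (r ^ 2 / 4) * (‖y r‖ ^ 2 + ‖S r‖ ^ 2) * B := by
          gcongr
          · exact le_add_of_nonneg_right (sq_nonneg _)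
          · exact hB r hr
      _ = _ := by ring
  have iF' : IntegrableOn F' (Ioi 0) := by
    refine h.integrableOn_of_le ?_ (2 * B) ?_
    · simp only [hF'def]
      fun_prop
    intro r hr
    simp only [hF'def]
    rw [norm_mul, norm_of_nonneg (hw r hr), norm_eq_abs]
    have b1 : |(4 * ζ r + r * ζ' r - r ^ 2 * ζ r / 2) * ‖y r‖ ^ 2| ≤ B * ‖y r‖ ^ 2 := by
      rw [abs_mul, abs_of_nonneg (sq_nonneg ‖y r‖)]
      gcongr
      exact hB' r hr
    have b2 : |2 * (r * ζ r) * (S r * conj (y r)).re| ≤ 2 * B * (‖S r‖ * ‖y r‖) := by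
      rw [abs_mul, abs_mul, abs_two]
      gcongr
      · exact hB r hr
      · exact hre r
    have b3 := sq_nonneg (‖S r‖ - ‖y r‖)
    calc _ ≤ r * exp (r ^ 2 / 4) * (B * ‖y r‖ ^ 2 + 2 * B * (‖S r‖ * ‖y r‖)) := by
          gcongr
          exact (abs_add_le _ _).trans (add_le_add b1 b2)
      _ ≤ r * exp (r ^ 2 / 4) * (2 * B * (‖y r‖ ^ 2 + ‖S r‖ ^ 2)) := by
          gcongr
          nlinarith [mul_nonneg hB0 b3, mul_nonneg hB0 (sq_nonneg ‖S r‖)]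
      _ = _ := by ring
  refine ⟨iF', integral_Ioi_zero_of_hasDerivAt hd iF iF' ?_⟩
  have hexp : Tendsto (fun r : ℝ => exp (r ^ 2 / 4) * B) (𝓝[>] 0) (𝓝 (exp (0 ^ 2 / 4) * B)) :=
    ((by fun_prop : Continuous fun r : ℝ => exp (r ^ 2 / 4) * B).tendsto 0).mono_left
      nhdsWithin_le_nhds
  have hz := h.lim_y.mul hexp
  rw [zero_mul] at hz
  refine squeeze_zero_norm' ?_ hz
  filter_upwards [self_mem_nhdsWithin] with r hr
  have hr' : (0 : ℝ) < r := hr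
  have : F r = r * exp (r ^ 2 / 4) * ‖y r‖ ^ 2 * (r * ζ r) := by simp only [F]; ring
  rw [this, norm_mul, norm_of_nonneg (mul_nonneg (hw r hr) (sq_nonneg _)), norm_eq_abs]
  calc _ ≤ r * exp (r ^ 2 / 4) * ‖y r‖ ^ 2 * B := by
        gcongr
        exact hB r hr
    _ = _ := by ring

end RadialSystem
end HalfLine

/-- The angular velocity of the Oseen vortex, as a function of `a = |ξ|²`. -/
def profile (a : ℝ) : ℝ := (2 * π)⁻¹ * a⁻¹ * (1 - exp (-a / 4))

/-- The derivative of `profile`. -/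
def profile' (a : ℝ) : ℝ :=
  (2 * π)⁻¹ * (-(a ^ 2)⁻¹ * (1 - exp (-a / 4)) + a⁻¹ * (exp (-a / 4) / 4))

theorem hasDerivAt_profile {a : ℝ} (ha : a ≠ 0) : HasDerivAt profile (profile' a) a := by
  have h1 := ((hasDerivAt_inv ha).const_mul (2 * π)⁻¹).mul
    ((((hasDerivAt_id' a).neg.div_const 4).exp).const_sub 1)
  refine h1.congr_deriv ?_
  simp only [profile', Pi.neg_apply]
  ring

theorem profile_nonneg {a : ℝ} (ha : 0 < a) : 0 ≤ profile a := by
  have h : exp (-a / 4) ≤ 1 := exp_le_one_iff.2 (by linarith)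
  have h' : 0 ≤ 1 - exp (-a / 4) := by linarith
  unfold profile
  positivity

theorem profile_le_one {a : ℝ} (ha : 0 < a) : profile a ≤ 1 := by
  have h := add_one_le_exp (-a / 4)
  have hp := pi_gt_three
  unfold profile
  rw [mul_assoc, inv_mul_le_iff₀ (by positivity), inv_mul_le_iff₀ ha]
  nlinarith

theorem profile'_le {a : ℝ} (ha : 0 < a) :
    a / (2 * π * (4 + a) ^ 2) ≤ -(2 * a * profile' a) := by
  have hp := pi_pos
  have hq := quadratic_le_exp_of_nonneg (x := a / 4) (by positivity)
  have he : exp (-a / 4) * exp (a / 4) = 1 := by rw [← exp_add]; simp [neg_div]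
  have hpos := exp_pos (-a / 4)
  set e := exp (-a / 4) with hedef
  have h1 : e * (1 + a / 4 + (a / 4) ^ 2 / 2) ≤ 1 := by
    calc _ ≤ e * exp (a / 4) := mul_le_mul_of_nonneg_left hq hpos.le
      _ = 1 := he
  have h2 : -(2 * a * profile' a) = (1 - e * (1 + a / 4)) / (π * a) := by
    simp only [profile', ← hedef]
    field_simp
    ring
  rw [h2, div_le_div_iff₀ (by positivity) (by positivity)]
  have h3 : (a / 4) ^ 2 / 2 / (1 + a / 4 + (a / 4) ^ 2 / 2) ≤ 1 - e * (1 + a / 4) := by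
    rw [div_le_iff₀ (by positivity)]
    nlinarith [mul_le_mul_of_nonneg_right h1 (by positivity : 0 ≤ 1 + a / 4)]
  have h4 : a ^ 2 / (2 * (4 + a) ^ 2) ≤ (a / 4) ^ 2 / 2 / (1 + a / 4 + (a / 4) ^ 2 / 2) := by
    rw [div_le_div_iff₀ (by positivity) (by positivity)]
    have := sq_nonneg a
    nlinarith [mul_nonneg (sq_nonneg a) ha.le, mul_nonneg (sq_nonneg a) (sq_nonneg a)]
  have h5 := h4.trans h3
  rw [div_le_iff₀ (by positivity)] at h5
  nlinarith

theorem neg_profile'_le {a : ℝ} (ha : 0 < a) : -(2 * a * profile' a) ≤ 2 := by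
  have h2 : -(2 * a * profile' a) = 2 * profile a - (2 * π)⁻¹ * (exp (-a / 4) / 2) := by
    simp only [profile', profile]
    field_simp
    ring
  have : 0 ≤ (2 * π)⁻¹ * (exp (-a / 4) / 2) := by positivity
  linarith [profile_le_one ha]

namespace RadialSystem

variable {M : ℝ} {Λ y S : ℝ → ℂ}

theorem re_mul_integral_eq (h : RadialSystem M Λ y S) (hΛ : ContinuousOn Λ (Ioi 0)) {L : ℝ}
    (hL : ∀ r : ℝ, 0 < r → ‖Λ r‖ ≤ L) {c : ℝ} (hc : ∀ r : ℝ, 0 < r → (Λ r).re = c) :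
    c * ∫ r in Ioi (0 : ℝ), r * exp (r ^ 2 / 4) * ‖y r‖ ^ 2
      = -∫ r in Ioi (0 : ℝ), r * exp (r ^ 2 / 4) * ‖S r‖ ^ 2 := by
  obtain ⟨hi, h0⟩ := h.energy_identity hΛ hL (η := fun _ => (1 : ℝ)) (η' := fun _ => (0 : ℝ))
    (B := 1)
    (fun r _ => hasDerivAt_const r 1) continuousOn_const (fun r _ => by simp)
    (fun r _ => by simp)
  have h1 := congrArg Complex.reCLM h0
  rw [← ContinuousLinearMap.integral_comp_comm _ hi, map_zero] at h1
  rw [eq_neg_iff_add_eq_zero, ← integral_const_mul, ← integral_add (h.int_y.const_mul c) h.int_S]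
  refine Eq.trans ?_ h1
  refine setIntegral_congr_fun (s := Ioi (0 : ℝ)) measurableSet_Ioi fun r hr => ?_
  simp only [Complex.reCLM_apply, Complex.re_ofReal_mul, Complex.add_re, Complex.ofReal_one,
    Complex.ofReal_zero, mul_zero, mul_one, Complex.ofReal_re, Complex.zero_re,
    Complex.re_mul_ofReal, hc r hr]
  ring

theorem im_mul_integral_eq (h : RadialSystem M Λ y S) (hΛ : ContinuousOn Λ (Ioi 0)) {L : ℝ}
    (hL : ∀ r : ℝ, 0 < r → ‖Λ r‖ ≤ L) {η η' : ℝ → ℝ} (hη : ∀ r : ℝ, 0 < r → HasDerivAt η (η' r) r)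
    (hη' : ContinuousOn η' (Ioi 0)) {B : ℝ} (hB : ∀ r : ℝ, 0 < r → |η r| ≤ B)
    (hB' : ∀ r : ℝ, 0 < r → |η' r| ≤ B) :
    IntegrableOn (fun r => r * exp (r ^ 2 / 4) *
      ((Λ r).im * η r * ‖y r‖ ^ 2 + η' r * (S r * conj (y r)).im)) (Ioi 0) ∧
    ∫ r in Ioi (0 : ℝ), r * exp (r ^ 2 / 4) *
      ((Λ r).im * η r * ‖y r‖ ^ 2 + η' r * (S r * conj (y r)).im) = 0 := by
  obtain ⟨hi, h0⟩ := h.energy_identity hΛ hL hη hη' hB hB'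
  have h1 := congrArg Complex.imCLM h0
  rw [← ContinuousLinearMap.integral_comp_comm _ hi, map_zero] at h1
  have h2 := Complex.imCLM.integrable_comp hi
  have he : (Complex.imCLM ∘ fun r : ℝ => ((r * exp (r ^ 2 / 4) : ℝ) : ℂ) *
      (Λ r * ((‖y r‖ ^ 2 : ℝ) : ℂ) * η r + ((‖S r‖ ^ 2 : ℝ) : ℂ) * η r
        + S r * conj (y r) * η' r)) = fun r => r * exp (r ^ 2 / 4) *
      ((Λ r).im * η r * ‖y r‖ ^ 2 + η' r * (S r * conj (y r)).im) := by
    funext r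
    simp only [Function.comp, Complex.imCLM_apply, Complex.im_ofReal_mul, Complex.add_im,
      Complex.im_mul_ofReal, Complex.ofReal_im]
    ring
  rw [← he]
  exact ⟨h2, h1⟩

theorem integral_y_pos (h : RadialSystem M Λ y S) {r₀ : ℝ} (hr₀ : 0 < r₀) (hy : y r₀ ≠ 0) :
    0 < ∫ r in Ioi (0 : ℝ), r * exp (r ^ 2 / 4) * ‖y r‖ ^ 2 := by
  have hnn : 0 ≤ᵐ[volume.restrict (Ioi (0 : ℝ))] fun r => r * exp (r ^ 2 / 4) * ‖y r‖ ^ 2 := by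
    filter_upwards [ae_restrict_mem measurableSet_Ioi] with r hr
    have : (0 : ℝ) < r := hr
    positivity
  rw [integral_pos_iff_support_of_nonneg_ae hnn h.int_y, Measure.restrict_apply' measurableSet_Ioi]
  have hev : ∀ᶠ r in 𝓝 r₀, r ∈ Function.support (fun r => r * exp (r ^ 2 / 4) * ‖y r‖ ^ 2) ∩
      Ioi (0 : ℝ) := by
    filter_upwards [(h.deriv_y r₀ hr₀).continuousAt.eventually_ne hy, Ioi_mem_nhds hr₀] with r h1 h2
    have : (0 : ℝ) < r := h2
    exact ⟨by simp [Function.mem_support, this.ne', h1], h2⟩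
  exact Measure.measure_pos_of_mem_nhds _ hev

theorem re_nonpos_of_re_eq (h : RadialSystem M Λ y S) (hΛ : ContinuousOn Λ (Ioi 0)) {L : ℝ}
    (hL : ∀ r : ℝ, 0 < r → ‖Λ r‖ ≤ L) {c : ℝ} (hc : ∀ r : ℝ, 0 < r → (Λ r).re = c)
    {r₀ : ℝ} (hr₀ : 0 < r₀) (hy : y r₀ ≠ 0) : c ≤ 0 := by
  have h1 := h.re_mul_integral_eq hΛ hL hc
  have h2 := h.integral_y_pos hr₀ hy
  have h3 : 0 ≤ ∫ r in Ioi (0 : ℝ), r * exp (r ^ 2 / 4) * ‖S r‖ ^ 2 :=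
    setIntegral_nonneg measurableSet_Ioi fun r hr => by
      have : (0 : ℝ) < r := hr
      positivity
  by_contra! h4
  nlinarith [mul_pos h4 h2]

end RadialSystem

theorem abs_div_le_of_abs_le_mul {p q B : ℝ} (hq : 0 < q) (h1 : p ≤ B * q) (h2 : -(B * q) ≤ p) :
    |p / q| ≤ B := by
  rw [abs_div, abs_of_pos hq, div_le_iff₀ hq]
  exact abs_le.2 ⟨h2, h1⟩

theorem continuousOn_profile_sq : ContinuousOn (fun r : ℝ => profile (r ^ 2)) (Ioi 0) :=
  fun r hr => ((hasDerivAt_profile (pow_ne_zero 2 (ne_of_gt hr))).continuousAt.comp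
    (f := fun r : ℝ => r ^ 2) (by fun_prop)).continuousWithinAt

theorem continuousOn_profile'_sq : ContinuousOn (fun r : ℝ => profile' (r ^ 2)) (Ioi 0) := by
  unfold profile'
  refine ContinuousOn.mul continuousOn_const (ContinuousOn.add (ContinuousOn.mul
    (ContinuousOn.neg (ContinuousOn.inv₀ (by fun_prop) ?_)) (by fun_prop))
    (ContinuousOn.mul (ContinuousOn.inv₀ (by fun_prop) ?_) (by fun_prop)))
  all_goals
    intro r hr
    have : (0 : ℝ) < r := hr
    positivity

/-- Lower bound on `-Re κ` for the first angular modes. -/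
def gap (β : ℝ) : ℝ := ((2 + 4 * (160 * π) + 4 * (160 * π) / |β|) ^ 2)⁻¹

theorem gap_pos {β : ℝ} : 0 < gap β := by
  have := pi_pos
  unfold gap
  positivity

namespace RadialSystem

variable {κ : ℂ} {β : ℝ} {y S Λ : ℝ → ℂ}

set_option maxHeartbeats 1000000 in
theorem re_le_neg_gap (hβ : β ≠ 0) (h : RadialSystem 1 Λ y S)
    (hΛ : ∀ r : ℝ, 0 < r → Λ r = κ + ((β * profile (r ^ 2) : ℝ) : ℂ) * Complex.I) {r₀ : ℝ}
    (hr₀ : 0 < r₀) (hy : y r₀ ≠ 0) : κ.re ≤ -gap β := by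
  have hπ := pi_pos
  have hp0 : ∀ r : ℝ, 0 < r → 0 ≤ profile (r ^ 2) := fun r hr => profile_nonneg (by positivity)
  have hp1 : ∀ r : ℝ, 0 < r → profile (r ^ 2) ≤ 1 := fun r hr => profile_le_one (by positivity)
  have hpa : ∀ r : ℝ, 0 < r → |profile (r ^ 2)| ≤ 1 := fun r hr =>
    abs_le.2 ⟨by linarith [hp0 r hr], hp1 r hr⟩
  have hΛc : ContinuousOn Λ (Ioi 0) := by
    refine ContinuousOn.congr ?_ (fun r hr => hΛ r hr)
    have := continuousOn_profile_sq
    fun_prop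
  have hre : ∀ r : ℝ, 0 < r → (Λ r).re = κ.re := fun r hr => by simp [hΛ r hr]
  have him : ∀ r : ℝ, 0 < r → (Λ r).im = κ.im + β * profile (r ^ 2) := fun r hr => by
    simp [hΛ r hr]
  have hL : ∀ r : ℝ, 0 < r → ‖Λ r‖ ≤ ‖κ‖ + |β| := fun r hr => by
    rw [hΛ r hr]
    refine (norm_add_le _ _).trans ?_
    rw [norm_mul, Complex.norm_I, mul_one, Complex.norm_real, norm_eq_abs, abs_mul]
    nlinarith [hpa r hr, abs_nonneg β]
  have hN := h.integral_y_pos hr₀ hy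
  have hNS := h.re_mul_integral_eq hΛc hL hre
  set N := ∫ r in Ioi (0 : ℝ), r * exp (r ^ 2 / 4) * ‖y r‖ ^ 2 with hNdef
  set Q := ∫ r in Ioi (0 : ℝ), r * exp (r ^ 2 / 4) * ‖S r‖ ^ 2 with hSdef
  have hw : ∀ r : ℝ, 0 < r → 0 < r * exp (r ^ 2 / 4) := fun r hr => by positivity
  -- the imaginary part of the eigenvalue is bounded by `|β|`
  have hc : |κ.im| ≤ |β| := by
    obtain ⟨hi, h0⟩ := h.im_mul_integral_eq hΛc hL (η := fun _ => (1 : ℝ)) (η' := fun _ => (0 : ℝ))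
      (B := 1) (fun r _ => hasDerivAt_const r 1) continuousOn_const (fun r _ => by simp)
      (fun r _ => by simp)
    have hb : ∀ r : ℝ, 0 < r → |β * profile (r ^ 2)| ≤ |β| := fun r hr => by
      rw [abs_mul]
      exact mul_le_of_le_one_right (abs_nonneg _) (hpa r hr)
    have m1 : (κ.im - |β|) * N ≤ 0 := by
      rw [← h0, hNdef, ← integral_const_mul]
      refine setIntegral_mono_on (h.int_y.const_mul _) hi measurableSet_Ioi fun r hr => ?_
      have e : 0 ≤ r * exp (r ^ 2 / 4) * ‖y r‖ ^ 2 := mul_nonneg (hw r hr).le (sq_nonneg _)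
      have := (abs_le.1 (hb r hr)).1
      rw [him r hr]
      nlinarith [mul_nonneg e (by linarith : 0 ≤ β * profile (r ^ 2) + |β|)]
    have m2 : 0 ≤ (κ.im + |β|) * N := by
      rw [← h0, hNdef, ← integral_const_mul]
      refine setIntegral_mono_on hi (h.int_y.const_mul _) measurableSet_Ioi fun r hr => ?_
      have e : 0 ≤ r * exp (r ^ 2 / 4) * ‖y r‖ ^ 2 := mul_nonneg (hw r hr).le (sq_nonneg _)
      have := (abs_le.1 (hb r hr)).2
      rw [him r hr]
      nlinarith [mul_nonneg e (by linarith : 0 ≤ |β| - β * profile (r ^ 2))]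
    refine abs_le.2 ⟨?_, ?_⟩
    · have := nonneg_of_mul_nonneg_left m2 hN
      linarith
    · have := nonpos_of_mul_nonpos_left m1 hN
      linarith
  -- the weights
  set p : ℝ → ℝ := fun r => profile (r ^ 2) with hp
  set p' : ℝ → ℝ := fun r => 2 * r * profile' (r ^ 2) with hp'
  let ζ : ℝ → ℝ := fun r => 4 / (4 + r ^ 2)
  let ζ' : ℝ → ℝ := fun r => -(8 * r) / (4 + r ^ 2) ^ 2
  let F : ℝ → ℝ := fun r => (64 - 2 * r ^ 4) / (4 + r ^ 2) ^ 2
  let F' : ℝ → ℝ := fun r => -(32 * r ^ 3 + 256 * r) / (4 + r ^ 2) ^ 3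
  let χ : ℝ → ℝ := fun r => 4 * (4 - r ^ 2) / (4 + r ^ 2) ^ 2
  let χ' : ℝ → ℝ := fun r => 8 * r * (r ^ 2 - 12) / (4 + r ^ 2) ^ 3
  let G : ℝ → ℝ := fun r => 2 * (r ^ 6 - 4 * r ^ 4 - 64 * r ^ 2 + 128) / (4 + r ^ 2) ^ 3
  have hq : ∀ r : ℝ, (4 + r ^ 2) ≠ 0 := fun r => by positivity
  have dq : ∀ r : ℝ, HasDerivAt (fun r : ℝ => 4 + r ^ 2) (2 * r) r := fun r => by
    simpa using (hasDerivAt_pow 2 r).const_add 4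
  have dp : ∀ r : ℝ, 0 < r → HasDerivAt p (p' r) r := fun r hr => by
    have := (hasDerivAt_profile (a := r ^ 2) (by positivity)).comp r (hasDerivAt_pow 2 r)
    refine this.congr_deriv ?_
    simp only [hp']
    push_cast
    ring
  have dζ : ∀ r : ℝ, HasDerivAt ζ (ζ' r) r := fun r => by
    refine ((hasDerivAt_const r (4 : ℝ)).div (dq r) (hq r)).congr_deriv ?_
    simp only [ζ']
    ring
  have dF : ∀ r : ℝ, HasDerivAt F (F' r) r := fun r => by
    have d1 : HasDerivAt (fun r : ℝ => 64 - 2 * r ^ 4) (-(8 * r ^ 3)) r := by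
      refine (((hasDerivAt_pow 4 r).const_mul 2).const_sub 64).congr_deriv ?_
      push_cast
      ring
    refine (d1.div ((dq r).fun_pow 2) (pow_ne_zero 2 (hq r))).congr_deriv ?_
    have := hq r
    simp only [F']
    field_simp
    push_cast
    ring
  have dχ : ∀ r : ℝ, HasDerivAt χ (χ' r) r := fun r => by
    have d1 : HasDerivAt (fun r : ℝ => 4 * (4 - r ^ 2)) (-(8 * r)) r := by
      refine (((hasDerivAt_pow 2 r).const_sub 4).const_mul 4).congr_deriv ?_
      push_cast
      ring
    refine (d1.div ((dq r).fun_pow 2) (pow_ne_zero 2 (hq r))).congr_deriv ?_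
    have := hq r
    simp only [χ']
    field_simp
    push_cast
    ring
  have eF : ∀ r : ℝ, 4 * ζ r + r * ζ' r - r ^ 2 * ζ r / 2 = F r := fun r => by
    have := hq r
    simp only [ζ, ζ', F]
    field_simp
    ring
  have eG : ∀ r : ℝ, 4 * χ r + r * χ' r - r ^ 2 * χ r / 2 = G r := fun r => by
    have := hq r
    simp only [χ, χ', G]
    field_simp
    ring
  have bζ0 : ∀ r : ℝ, 0 < r → |ζ r| ≤ 1 := fun r hr =>
    abs_div_le_of_abs_le_mul (by positivity) (by nlinarith) (by nlinarith)
  have bζ : ∀ r : ℝ, 0 < r → |r * ζ r| ≤ 1 := fun r hr => by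
    have : r * ζ r = 4 * r / (4 + r ^ 2) := by simp only [ζ]; ring
    rw [this]
    exact abs_div_le_of_abs_le_mul (by positivity) (by nlinarith [sq_nonneg (r - 2)])
      (by nlinarith)
  have bχ : ∀ r : ℝ, 0 < r → |r * χ r| ≤ 1 := fun r hr => by
    have : r * χ r = 4 * r * (4 - r ^ 2) / (4 + r ^ 2) ^ 2 := by simp only [χ]; ring
    rw [this]
    have h1 : 4 * r ≤ 4 + r ^ 2 := by nlinarith [sq_nonneg (r - 2)]
    refine abs_div_le_of_abs_le_mul (by positivity) ?_ ?_
    · nlinarith [mul_nonneg hr.le (sq_nonneg r), mul_nonneg (by linarith : 0 ≤ 4 + r ^ 2 - 4 * r)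
        (by positivity : 0 ≤ 4 + r ^ 2)]
    · nlinarith [mul_nonneg hr.le (sq_nonneg r), mul_nonneg (by linarith : 0 ≤ 4 + r ^ 2 - 4 * r)
        (by positivity : 0 ≤ 4 + r ^ 2)]
  have bF : ∀ r : ℝ, 0 < r → |F r| ≤ 4 := fun r hr =>
    abs_div_le_of_abs_le_mul (by positivity) (by nlinarith [sq_nonneg (r ^ 2)])
      (by nlinarith [sq_nonneg (r ^ 2)])
  have bF' : ∀ r : ℝ, 0 < r → |F' r| ≤ 4 := fun r hr => by
    have h1 : 4 * r ≤ 4 + r ^ 2 := by nlinarith [sq_nonneg (r - 2)]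
    refine abs_div_le_of_abs_le_mul (by positivity) ?_ ?_
    · have : 0 ≤ 32 * r ^ 3 + 256 * r := by positivity
      have : 0 ≤ 4 * (4 + r ^ 2) ^ 3 := by positivity
      linarith
    · have e : 32 * r ^ 3 + 256 * r = 4 * r * (8 * r ^ 2 + 64) := by ring
      have h2 : 4 * r * (8 * r ^ 2 + 64) ≤ (4 + r ^ 2) * (8 * r ^ 2 + 64) := by gcongr
      nlinarith [sq_nonneg (r ^ 2), mul_nonneg (sq_nonneg r) (sq_nonneg (r ^ 2))]
  have bG : ∀ r : ℝ, 0 < r → |G r| ≤ 4 := fun r hr => by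
    have a0 : 0 ≤ r ^ 2 := sq_nonneg r
    refine abs_div_le_of_abs_le_mul (by positivity) ?_ ?_
    · nlinarith [mul_nonneg a0 (sq_nonneg (r ^ 2)), sq_nonneg (r ^ 2)]
    · nlinarith [mul_nonneg a0 (sq_nonneg (r ^ 2)), sq_nonneg (r ^ 2)]
  have bp : ∀ r : ℝ, 0 < r → |r * p' r| ≤ 2 := fun r hr => by
    have e : r * p' r = 2 * r ^ 2 * profile' (r ^ 2) := by simp only [hp']; ring
    have ha : 0 < r ^ 2 := by positivity
    have h1 := profile'_le ha
    have h2 := neg_profile'_le ha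
    have h3 : 0 ≤ r ^ 2 / (2 * π * (4 + r ^ 2) ^ 2) := by positivity
    rw [e]
    exact abs_le.2 ⟨by linarith, by linarith⟩
  have cp : ContinuousOn p (Ioi 0) := continuousOn_profile_sq
  have cp' : ContinuousOn p' (Ioi 0) := by
    have := continuousOn_profile'_sq
    simp only [hp']
    fun_prop
  have cζ : Continuous ζ := by
    simp only [ζ]
    fun_prop (disch := exact hq)
  have cζ' : Continuous ζ' := continuous_iff_continuousAt.2 fun r => by
    have := hq r
    simp only [ζ']
    fun_prop (disch := positivity)
  have cF' : Continuous F' := continuous_iff_continuousAt.2 fun r => by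
    have := hq r
    simp only [F']
    fun_prop (disch := positivity)
  have cχ' : Continuous χ' := continuous_iff_continuousAt.2 fun r => by
    have := hq r
    simp only [χ']
    fun_prop (disch := positivity)
  obtain ⟨i1, z1⟩ := h.im_mul_integral_eq hΛc hL (fun r _ => dF r) cF'.continuousOn bF bF'
  obtain ⟨i2, z2⟩ := h.weight_identity (fun r _ => dζ r) cζ'.continuousOn (B := 4)
    (fun r hr => (bζ r hr).trans (by norm_num)) (fun r hr => by rw [eF]; exact bF r hr)
  obtain ⟨i4, z4⟩ := h.weight_identity (fun r _ => dχ r) cχ'.continuousOn (B := 4)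
    (fun r hr => (bχ r hr).trans (by norm_num)) (fun r hr => by rw [eG]; exact bG r hr)
  have eH : ∀ r : ℝ, 4 * (p r * ζ r) + r * (p' r * ζ r + p r * ζ' r) - r ^ 2 * (p r * ζ r) / 2
      = p r * F r + r * p' r * ζ r := fun r => by
    rw [← eF]
    ring
  obtain ⟨i3, z3⟩ := h.weight_identity (ζ := fun r => p r * ζ r)
    (ζ' := fun r => p' r * ζ r + p r * ζ' r) (fun r hr => (dp r hr).mul (dζ r))
    (by fun_prop) (B := 8)
    (fun r hr => by
      rw [show r * (p r * ζ r) = p r * (r * ζ r) by ring, abs_mul]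
      have := mul_le_mul (hpa r hr) (bζ r hr) (abs_nonneg _) zero_le_one
      linarith)
    (fun r hr => by
      rw [eH]
      refine (abs_add_le _ _).trans ?_
      rw [abs_mul, abs_mul (r * p' r)]
      have h1 := mul_le_mul (hpa r hr) (bF r hr) (abs_nonneg _) zero_le_one
      have h2 := mul_le_mul (bp r hr) (bζ0 r hr) (abs_nonneg _) zero_le_two
      simp only [hp] at h1 h2 ⊢
      linarith)
  obtain ⟨K, hK⟩ : ∃ K, K = 160 * π := ⟨_, rfl⟩
  have hKpos : 0 < K := by rw [hK]; positivity
  have hβ' : 0 < |β| := abs_pos.2 hβ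
  obtain ⟨C, hC⟩ : ∃ C, C = 2 + 4 * K + 4 * K / |β| := ⟨_, rfl⟩
  have hCpos : 0 < C := by rw [hC]; positivity
  have hI := (i4.sub (i3.const_mul K)).add ((i1.sub (i2.const_mul κ.im)).const_mul (K / β))
  have hz := integral_add (i4.sub (i3.const_mul K))
    ((i1.sub (i2.const_mul κ.im)).const_mul (K / β))
  simp only [Pi.sub_apply] at hz
  rw [integral_sub i4 (i3.const_mul K), integral_const_mul, integral_const_mul,
    integral_sub i1 (i2.const_mul κ.im), integral_const_mul, z1, z2, z3, z4] at hz
  have hJ := (h.int_y.const_mul (1 / 2)).sub (h.int_S.const_mul (C ^ 2 / 2))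
  have hz' := integral_sub (h.int_y.const_mul (1 / 2)) (h.int_S.const_mul (C ^ 2 / 2))
  rw [integral_const_mul, integral_const_mul, ← hNdef, ← hSdef] at hz'
  have hmono := setIntegral_mono_on hJ hI measurableSet_Ioi fun r hr => ?_
  · simp only [Pi.sub_apply, Pi.add_apply] at hmono
    rw [hz, hz'] at hmono
    have h1 : N ≤ C ^ 2 * (-(κ.re * N)) := by
      rw [hNS]
      linarith
    have h2 : 1 ≤ C ^ 2 * -κ.re := by
      by_contra! h3
      nlinarith [mul_lt_mul_of_pos_right h3 hN]
    have h4 : (C ^ 2)⁻¹ ≤ -κ.re := by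
      rw [inv_le_iff_one_le_mul₀ (by positivity)]
      linarith
    have : gap β = (C ^ 2)⁻¹ := by rw [hC, hK, gap]
    linarith
  have hr' : (0 : ℝ) < r := hr
  have hcoef : ‖y r‖ ^ 2 ≤ (G r - K * (r * p' r * ζ r)) * ‖y r‖ ^ 2 := by
    refine le_mul_of_one_le_left (sq_nonneg _) ?_
    have ha : 0 < r ^ 2 := by positivity
    have h1 := profile'_le ha
    have e : -(r * p' r) = -(2 * r ^ 2 * profile' (r ^ 2)) := by simp only [hp']; ring
    have h2 : K * (r ^ 2 / (2 * π * (4 + r ^ 2) ^ 2) * ζ r) ≤ K * (-(r * p' r) * ζ r) := by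
      rw [e]
      have : 0 ≤ ζ r := by simp only [ζ]; positivity
      gcongr
    have h3 : 1 ≤ G r + K * (r ^ 2 / (2 * π * (4 + r ^ 2) ^ 2) * ζ r) := by
      have e3 : G r + K * (r ^ 2 / (2 * π * (4 + r ^ 2) ^ 2) * ζ r)
          = (2 * (r ^ 6 - 4 * r ^ 4 - 64 * r ^ 2 + 128) + 320 * r ^ 2) / (4 + r ^ 2) ^ 3 := by
        have := hq r
        simp only [G, ζ, hK]
        field_simp
        ring
      rw [e3, le_div_iff₀ (by positivity)]
      nlinarith [mul_nonneg ha.le (sq_nonneg (r ^ 2 - 10))]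
    linarith
  have hRe : |(S r * conj (y r)).re| ≤ ‖S r‖ * ‖y r‖ := by
    simpa using Complex.abs_re_le_norm (S r * conj (y r))
  have hIm : |(S r * conj (y r)).im| ≤ ‖S r‖ * ‖y r‖ := by
    simpa using Complex.abs_im_le_norm (S r * conj (y r))
  have hSy : 0 ≤ ‖S r‖ * ‖y r‖ := by positivity
  have k1 : |2 * (r * χ r) * (S r * conj (y r)).re| ≤ 2 * (‖S r‖ * ‖y r‖) := by
    have := mul_le_mul (bχ r hr') hRe (abs_nonneg _) zero_le_one
    rw [abs_mul, abs_mul, abs_two]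
    linarith
  have k2 : |K * (2 * (p r * (r * ζ r)) * (S r * conj (y r)).re)| ≤ 2 * K * (‖S r‖ * ‖y r‖) := by
    have := mul_le_mul (mul_le_mul (hpa r hr') (bζ r hr') (abs_nonneg _) zero_le_one) hRe
      (abs_nonneg _) (by norm_num)
    rw [abs_mul, abs_mul, abs_mul, abs_mul, abs_two, abs_of_pos hKpos]
    nlinarith
  have k3 : |K / β * (F' r * (S r * conj (y r)).im)| ≤ 4 * K / |β| * (‖S r‖ * ‖y r‖) := by
    have := mul_le_mul (bF' r hr') hIm (abs_nonneg _) zero_le_four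
    rw [abs_mul, abs_mul, abs_div, abs_of_pos hKpos]
    calc _ ≤ K / |β| * (4 * (‖S r‖ * ‖y r‖)) := by gcongr
      _ = _ := by ring
  have k4 : |K / β * κ.im * (2 * (r * ζ r) * (S r * conj (y r)).re)|
      ≤ 2 * K * (‖S r‖ * ‖y r‖) := by
    have := mul_le_mul (bζ r hr') hRe (abs_nonneg _) zero_le_one
    rw [abs_mul, abs_mul, abs_mul, abs_mul, abs_two, abs_div, abs_of_pos hKpos, mul_assoc 2]
    calc _ ≤ K / |β| * |β| * (2 * (1 * (‖S r‖ * ‖y r‖))) := by gcongr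
      _ = _ := by field_simp
  rw [abs_le] at k1 k2 k3 k4
  have hsq := sq_nonneg (‖y r‖ - C * ‖S r‖)
  have hfin : 1 / 2 * ‖y r‖ ^ 2 - C ^ 2 / 2 * ‖S r‖ ^ 2
      ≤ (G r - K * (r * p' r * ζ r)) * ‖y r‖ ^ 2
        + 2 * (r * χ r) * (S r * conj (y r)).re
        - K * (2 * (p r * (r * ζ r)) * (S r * conj (y r)).re)
        + K / β * (F' r * (S r * conj (y r)).im)
        - K / β * κ.im * (2 * (r * ζ r) * (S r * conj (y r)).re) := by
    have hCe : C * (‖S r‖ * ‖y r‖) = 2 * (‖S r‖ * ‖y r‖) + 2 * K * (‖S r‖ * ‖y r‖)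
        + 4 * K / |β| * (‖S r‖ * ‖y r‖) + 2 * K * (‖S r‖ * ‖y r‖) := by
      rw [hC]
      ring
    nlinarith [k1.1, k2.2, k3.1, k4.2]
  simp only [Pi.sub_apply, Pi.add_apply, eF, eG, eH, him r hr']
  have hK' : K / β * β = K := div_mul_cancel₀ K hβ
  have := mul_le_mul_of_nonneg_left hfin (hw r hr').le
  calc _ = r * exp (r ^ 2 / 4) * (1 / 2 * ‖y r‖ ^ 2 - C ^ 2 / 2 * ‖S r‖ ^ 2) := by ring
    _ ≤ _ := this
    _ = _ := by
      linear_combination (-(r * exp (r ^ 2 / 4) * (p r * F r * ‖y r‖ ^ 2))) * hK'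

end RadialSystem

/-- An angular mode of index `m` of an eigenfunction, with its first two radial derivatives. -/
structure RadialMode (m : ℤ) (β : ℝ) (κ : ℂ) (y y₁ y₂ : ℝ → ℂ) : Prop where
  deriv_y : ∀ r, HasDerivAt y (y₁ r) r
  deriv_y₁ : ∀ r, HasDerivAt y₁ (y₂ r) r
  continuous_y₂ : Continuous y₂
  integrable : IntegrableOn (fun r => r * exp (r ^ 2 / 4) *
    ((1 + r ^ 2) ^ 2 * (‖y r‖ ^ 2 + ‖y₁ r‖ ^ 2 + ‖y₂ r‖ ^ 2))) (Ioi 0)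
  ode : ∀ r : ℝ, 0 < r → (r : ℂ) ^ 2 * y₂ r + r * y₁ r - (m : ℂ) ^ 2 * y r + (r : ℂ) ^ 3 / 2 * y₁ r
    + 3 / 2 * (r : ℂ) ^ 2 * y r
    - ((β * m * profile (r ^ 2) : ℝ) : ℂ) * Complex.I * (r : ℂ) ^ 2 * y r = κ * (r : ℂ) ^ 2 * y r

namespace RadialMode

variable {m : ℤ} {β : ℝ} {κ : ℂ} {y y₁ y₂ : ℝ → ℂ}

theorem continuous_y (h : RadialMode m β κ y y₁ y₂) : Continuous y :=
  continuous_iff_continuousAt.2 fun r => (h.deriv_y r).continuousAt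

theorem continuous_y₁ (h : RadialMode m β κ y y₁ y₂) : Continuous y₁ :=
  continuous_iff_continuousAt.2 fun r => (h.deriv_y₁ r).continuousAt

theorem integrableOn_of_le (h : RadialMode m β κ y y₁ y₂) {F : ℝ → ℂ}
    (hF : ContinuousOn F (Ioi 0)) {C : ℝ}
    (hC : ∀ r : ℝ, 0 < r → ‖F r‖ ≤ C * ((1 + r ^ 2) * (‖y r‖ + ‖y₁ r‖ + ‖y₂ r‖))) :
    IntegrableOn (fun r => r * exp (r ^ 2 / 4) * ‖F r‖ ^ 2) (Ioi 0) := by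
  refine Integrable.mono' (h.integrable.const_mul (3 * C ^ 2))
    (ContinuousOn.aestronglyMeasurable (by fun_prop) measurableSet_Ioi) ?_
  filter_upwards [ae_restrict_mem measurableSet_Ioi] with r hr
  have hr' : (0 : ℝ) < r := hr
  rw [norm_of_nonneg (by positivity)]
  have h1 : ‖F r‖ ^ 2 ≤ (C * ((1 + r ^ 2) * (‖y r‖ + ‖y₁ r‖ + ‖y₂ r‖))) ^ 2 :=
    pow_le_pow_left₀ (norm_nonneg _) (hC r hr') 2
  have h2 : (‖y r‖ + ‖y₁ r‖ + ‖y₂ r‖) ^ 2 ≤ 3 * (‖y r‖ ^ 2 + ‖y₁ r‖ ^ 2 + ‖y₂ r‖ ^ 2) := by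
    nlinarith [sq_nonneg (‖y r‖ - ‖y₁ r‖), sq_nonneg (‖y r‖ - ‖y₂ r‖),
      sq_nonneg (‖y₁ r‖ - ‖y₂ r‖)]
  calc _ ≤ r * exp (r ^ 2 / 4) * (C * ((1 + r ^ 2) * (‖y r‖ + ‖y₁ r‖ + ‖y₂ r‖))) ^ 2 := by
        gcongr
    _ = r * exp (r ^ 2 / 4) * (C ^ 2 * ((1 + r ^ 2) ^ 2 * (‖y r‖ + ‖y₁ r‖ + ‖y₂ r‖) ^ 2)) := by
        ring
    _ ≤ r * exp (r ^ 2 / 4) * (C ^ 2 * ((1 + r ^ 2) ^ 2 *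
          (3 * (‖y r‖ ^ 2 + ‖y₁ r‖ ^ 2 + ‖y₂ r‖ ^ 2)))) := by gcongr
    _ = _ := by ring

theorem tendsto_of_le (h : RadialMode m β κ y y₁ y₂) {F G : ℝ → ℂ} {C : ℝ}
    (hF : ∀ r : ℝ, 0 < r → ‖F r‖ ≤ C * ((1 + r ^ 2) * (‖y r‖ + ‖y₁ r‖ + ‖y₂ r‖)))
    (hG : ∀ r : ℝ, 0 < r → ‖G r‖ ≤ C * ((1 + r ^ 2) * (‖y r‖ + ‖y₁ r‖ + ‖y₂ r‖))) :
    Tendsto (fun r => r * (‖F r‖ * ‖G r‖)) (𝓝[>] 0) (𝓝 0) := by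
  have c0 := h.continuous_y
  have c1 := h.continuous_y₁
  have c2 := h.continuous_y₂
  have hc : Continuous fun r : ℝ =>
      r * (C * ((1 + r ^ 2) * (‖y r‖ + ‖y₁ r‖ + ‖y₂ r‖))) ^ 2 := by fun_prop
  have ht := (hc.tendsto 0).mono_left (nhdsWithin_le_nhds (s := Ioi 0))
  simp only [zero_mul] at ht
  refine squeeze_zero' ?_ ?_ ht
  · filter_upwards [self_mem_nhdsWithin] with r hr
    have hr' : (0 : ℝ) < r := hr
    positivity
  · filter_upwards [self_mem_nhdsWithin] with r hr
    have hs : (0 : ℝ) < r := hr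
    have := hF r hs
    have := hG r hs
    rw [sq]
    gcongr
    exact (norm_nonneg _).trans (hF r hs)

/-- A bound on a linear combination of a mode and its derivatives with coefficients growing at
most quadratically. -/
theorem norm_combination_le {a b c p q s : ℂ} {r C : ℝ} (ha : ‖a‖ ≤ C * (1 + r ^ 2))
    (hb : ‖b‖ ≤ C * (1 + r ^ 2)) (hc : ‖c‖ ≤ C * (1 + r ^ 2)) :
    ‖a * p + b * q + c * s‖ ≤ C * ((1 + r ^ 2) * (‖p‖ + ‖q‖ + ‖s‖)) := by
  refine (norm_add₃_le).trans ?_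
  rw [norm_mul, norm_mul, norm_mul]
  calc _ ≤ C * (1 + r ^ 2) * ‖p‖ + C * (1 + r ^ 2) * ‖q‖ + C * (1 + r ^ 2) * ‖s‖ := by gcongr
    _ = _ := by ring

theorem norm_le (r : ℝ) {y y₁ y₂ : ℝ → ℂ} {C : ℝ} (hC : 1 ≤ C) :
    ‖y r‖ ≤ C * ((1 + r ^ 2) * (‖y r‖ + ‖y₁ r‖ + ‖y₂ r‖)) := by
  have h1 : 1 ≤ C * (1 + r ^ 2) := by nlinarith [sq_nonneg r]
  have h2 : ‖y r‖ ≤ ‖y r‖ + ‖y₁ r‖ + ‖y₂ r‖ := by linarith [norm_nonneg (y₁ r), norm_nonneg (y₂ r)]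
  rw [← mul_assoc]
  exact h2.trans (le_mul_of_one_le_left (by positivity) h1)

theorem hasDerivAt_S (h : RadialMode m β κ y y₁ y₂) {M : ℝ} (hM : M ^ 2 = (m : ℝ) ^ 2) {r : ℝ}
    (hr : 0 < r) :
    HasDerivAt (fun r : ℝ => y₁ r + ((r / 2 - M / r : ℝ) : ℂ) * y r)
      (-(((1 + M) / r : ℝ) : ℂ) * (y₁ r + ((r / 2 - M / r : ℝ) : ℂ) * y r)
        + ((κ + ((M - 1) / 2 : ℝ)) + ((β * m * profile (r ^ 2) : ℝ) : ℂ) * Complex.I) * y r) r := by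
  have d1 : HasDerivAt (fun r : ℝ => r / 2 - M / r) (1 / 2 + M / r ^ 2) r := by
    have := ((hasDerivAt_id' r).div_const 2).sub ((hasDerivAt_inv hr.ne').const_mul M)
    simp only [← div_eq_mul_inv] at this
    refine this.congr_deriv ?_
    field_simp
    ring
  refine ((h.deriv_y₁ r).add (d1.ofReal_comp.mul (h.deriv_y r))).congr_deriv ?_
  have hr' : (r : ℂ) ≠ 0 := by exact_mod_cast hr.ne'
  have hM' : (M : ℂ) ^ 2 = (m : ℂ) ^ 2 := by exact_mod_cast hM
  have ho := h.ode r hr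
  rw [← hM'] at ho
  push_cast at ho ⊢
  field_simp
  linear_combination 2 * ho

theorem deriv_y_S (h : RadialMode m β κ y y₁ y₂) (M : ℝ) (r : ℝ) :
    HasDerivAt y (y₁ r + ((r / 2 - M / r : ℝ) : ℂ) * y r - ((r / 2 - M / r : ℝ) : ℂ) * y r) r := by
  simpa using h.deriv_y r

theorem radialSystem_of_ne_zero (h : RadialMode m β κ y y₁ y₂) (hm : m ≠ 0) :
    RadialSystem |(m : ℝ)|
      (fun r => (κ + ((|(m : ℝ)| - 1) / 2 : ℝ)) + ((β * m * profile (r ^ 2) : ℝ) : ℂ) * Complex.I)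
      y (fun r => y₁ r + ((r / 2 - |(m : ℝ)| / r : ℝ) : ℂ) * y r) := by
  set M : ℝ := |(m : ℝ)| with hMdef
  have hM2 : M ^ 2 = (m : ℝ) ^ 2 := sq_abs _
  have hM1 : 1 ≤ M := by
    rw [hMdef, ← Int.cast_abs]
    exact_mod_cast Int.one_le_abs hm
  have hM0 : 0 < M := by linarith
  set S : ℝ → ℂ := fun r => y₁ r + ((r / 2 - M / r : ℝ) : ℂ) * y r with hS
  have c0 := h.continuous_y
  have hSd := fun (r : ℝ) (hr : 0 < r) => h.hasDerivAt_S hM2 hr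
  have hSc : ContinuousOn S (Ioi 0) := fun r hr => (hSd r hr).continuousAt.continuousWithinAt
  set C : ℝ := 4 + ‖κ‖ + |β| * M with hC
  have hC1 : 1 ≤ C := by
    have : 0 ≤ |β| * M := by positivity
    linarith [norm_nonneg κ]
  have hSle : ∀ r : ℝ, 0 < r → ‖S r‖ ≤ C * ((1 + r ^ 2) * (‖y r‖ + ‖y₁ r‖ + ‖y₂ r‖)) := by
    intro r hr
    have hr' : (r : ℂ) ≠ 0 := by exact_mod_cast hr.ne'
    have hM' : (M : ℂ) ≠ 0 := by exact_mod_cast hM0.ne'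
    have hMc : (M : ℂ) ^ 2 = (m : ℂ) ^ 2 := by exact_mod_cast hM2
    have e : S r = ((r / 2 : ℝ) - ((r / M : ℝ) : ℂ) * (3 / 2 - κ
          - ((β * m * profile (r ^ 2) : ℝ) : ℂ) * Complex.I)) * y r
        + (1 - ((1 + r ^ 2 / 2) / M : ℝ)) * y₁ r + (-(r / M : ℝ)) * y₂ r := by
      have ho := h.ode r hr
      rw [← hMc] at ho
      simp only [hS]
      push_cast at ho ⊢
      field_simp
      linear_combination 2 * ho
    rw [e]
    have hrb : r ≤ (1 + r ^ 2) / 2 := by nlinarith [sq_nonneg (r - 1)]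
    have hrM : r / M ≤ r := div_le_self hr.le hM1
    have hβ : ‖((β * m * profile (r ^ 2) : ℝ) : ℂ) * Complex.I‖ ≤ |β| * M := by
      rw [norm_mul, Complex.norm_I, mul_one, Complex.norm_real, norm_eq_abs, abs_mul, abs_mul,
        abs_of_nonneg (profile_nonneg (by positivity : 0 < r ^ 2))]
      exact mul_le_of_le_one_right (by positivity) (profile_le_one (by positivity))
    have hβM : 0 ≤ |β| * M := by positivity
    have hκ := norm_nonneg κ
    refine norm_combination_le ?_ ?_ ?_
    · have h3 : ‖(3 / 2 - κ - ((β * m * profile (r ^ 2) : ℝ) : ℂ) * Complex.I)‖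
          ≤ 3 / 2 + ‖κ‖ + |β| * M := by
        refine (norm_sub_le _ _).trans (add_le_add ((norm_sub_le _ _).trans ?_) hβ)
        have : ‖(3 / 2 : ℂ)‖ = 3 / 2 := by norm_num
        linarith
      refine (norm_sub_le _ _).trans ?_
      rw [norm_mul, Complex.norm_real, Complex.norm_real, norm_of_nonneg (by positivity),
        norm_of_nonneg (by positivity)]
      calc _ ≤ r / 2 + r * (3 / 2 + ‖κ‖ + |β| * M) := by gcongr
        _ = r * (2 + ‖κ‖ + |β| * M) := by ring
        _ ≤ (1 + r ^ 2) * C := by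
          gcongr
          · nlinarith
          · linarith
        _ = _ := by ring
    · refine (norm_sub_le _ _).trans ?_
      rw [norm_one, Complex.norm_real, norm_of_nonneg (by positivity)]
      have : (1 + r ^ 2 / 2) / M ≤ 1 + r ^ 2 / 2 := div_le_self (by positivity) hM1
      nlinarith [sq_nonneg r]
    · rw [norm_neg, Complex.norm_real, norm_of_nonneg (by positivity)]
      nlinarith [sq_nonneg r]
  have hyle : ∀ r : ℝ, 0 < r → ‖y r‖ ≤ C * ((1 + r ^ 2) * (‖y r‖ + ‖y₁ r‖ + ‖y₂ r‖)) :=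
    fun r _ => norm_le r hC1
  refine ⟨fun r _ => h.deriv_y_S M r, hSd, h.integrableOn_of_le c0.continuousOn hyle,
    h.integrableOn_of_le hSc hSle, ?_, h.tendsto_of_le hSle hyle⟩
  simpa only [sq] using h.tendsto_of_le hyle hyle

theorem radialSystem_zero (h : RadialMode 0 β κ y y₁ y₂) :
    RadialSystem 0 (fun _ => κ - 1 / 2) y (fun r => y₁ r + ((r / 2 : ℝ) : ℂ) * y r) := by
  have c0 := h.continuous_y
  have c1 := h.continuous_y₁
  have hyle : ∀ r : ℝ, 0 < r → ‖y r‖ ≤ 1 * ((1 + r ^ 2) * (‖y r‖ + ‖y₁ r‖ + ‖y₂ r‖)) :=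
    fun r _ => norm_le r le_rfl
  have hSle : ∀ r : ℝ, 0 < r → ‖y₁ r + ((r / 2 : ℝ) : ℂ) * y r‖
      ≤ 1 * ((1 + r ^ 2) * (‖y r‖ + ‖y₁ r‖ + ‖y₂ r‖)) := fun r hr => by
    have := norm_combination_le (a := ((r / 2 : ℝ) : ℂ)) (b := 1) (c := 0) (p := y r) (q := y₁ r)
      (s := y₂ r) (r := r) (C := 1) ?_ ?_ ?_
    · simpa [add_comm] using this
    · rw [Complex.norm_real, norm_of_nonneg (by positivity)]
      nlinarith [sq_nonneg (r - 1)]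
    · rw [norm_one]
      nlinarith [sq_nonneg r]
    · rw [norm_zero]
      positivity
  refine ⟨fun r _ => ?_, fun r hr => ?_, h.integrableOn_of_le c0.continuousOn hyle,
    h.integrableOn_of_le (by fun_prop) hSle, ?_, h.tendsto_of_le hSle hyle⟩
  · simpa using h.deriv_y r
  · have := h.hasDerivAt_S (M := 0) (by simp) hr
    simp only [zero_div, sub_zero] at this
    refine this.congr_deriv ?_
    push_cast
    ring
  · simpa only [sq] using h.tendsto_of_le hyle hyle

/-- For the radial mode, `z = y' + r y / 2` solves the radial system of index one. -/
theorem radialSystem_one_of_zero (h : RadialMode 0 β κ y y₁ y₂) :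
    RadialSystem 1 (fun _ => κ + 1 / 2) (fun r => y₁ r + ((r / 2 : ℝ) : ℂ) * y r)
      (fun r => -(2 / r : ℝ) * (y₁ r + ((r / 2 : ℝ) : ℂ) * y r)
        + (r / 2 : ℝ) * (y₁ r + ((r / 2 : ℝ) : ℂ) * y r) + (κ - 1 / 2) * y r) := by
  have h0 := h.radialSystem_zero
  have c0 := h.continuous_y
  have c1 := h.continuous_y₁
  set z : ℝ → ℂ := fun r => y₁ r + ((r / 2 : ℝ) : ℂ) * y r with hz
  set S : ℝ → ℂ := fun r => -(2 / r : ℝ) * z r + (r / 2 : ℝ) * z r + (κ - 1 / 2) * y r with hS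
  set C : ℝ := 4 + 3 * ‖κ‖ with hC
  have hC1 : 1 ≤ C := by linarith [norm_nonneg κ]
  have hzle : ∀ r : ℝ, 0 < r → ‖z r‖ ≤ C * ((1 + r ^ 2) * (‖y r‖ + ‖y₁ r‖ + ‖y₂ r‖)) := by
    intro r hr
    have e : z r = ((r / 2 : ℝ) : ℂ) * y r + 1 * y₁ r + 0 * y₂ r := by simp only [hz]; ring
    rw [e]
    refine norm_combination_le ?_ ?_ ?_
    · rw [Complex.norm_real, norm_of_nonneg (by positivity)]
      nlinarith [sq_nonneg (r - 1)]
    · rw [norm_one]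
      nlinarith [sq_nonneg r]
    · rw [norm_zero]
      positivity
  have hSle : ∀ r : ℝ, 0 < r → ‖S r‖ ≤ C * ((1 + r ^ 2) * (‖y r‖ + ‖y₁ r‖ + ‖y₂ r‖)) := by
    intro r hr
    have hr' : (r : ℂ) ≠ 0 := by exact_mod_cast hr.ne'
    have e : S r = ((r ^ 2 / 4 + 3 / 2 : ℝ) - κ) * y r + ((3 / 2 * r : ℝ) : ℂ) * y₁ r
        + 2 * y₂ r := by
      have ho := h.ode r hr
      simp only [hS, hz]
      push_cast at ho ⊢
      linear_combination (norm := (field_simp; ring)) -2 / (r : ℂ) ^ 2 * ho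
    rw [e]
    refine norm_combination_le ?_ ?_ ?_
    · refine (norm_sub_le _ _).trans ?_
      rw [Complex.norm_real, norm_of_nonneg (by positivity)]
      nlinarith [sq_nonneg r, norm_nonneg κ, mul_nonneg (sq_nonneg r) (norm_nonneg κ)]
    · rw [Complex.norm_real, norm_of_nonneg (by positivity)]
      nlinarith [sq_nonneg (r - 1), norm_nonneg κ]
    · have : ‖(2 : ℂ)‖ = 2 := by norm_num
      rw [this]
      nlinarith [sq_nonneg r, norm_nonneg κ]
  have hdz : ∀ r : ℝ, 0 < r → HasDerivAt z (-((1 / r : ℝ) : ℂ) * z r + (κ - 1 / 2) * y r) r := by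
    intro r hr
    refine (h0.deriv_S r hr).congr_deriv ?_
    simp only [add_zero]
  have hdS : ∀ r : ℝ, 0 < r →
      HasDerivAt S (-(((1 + 1) / r : ℝ) : ℂ) * S r + (κ + 1 / 2) * z r) r := by
    intro r hr
    have hr' : (r : ℂ) ≠ 0 := by exact_mod_cast hr.ne'
    have d1 : HasDerivAt (fun r : ℝ => ((2 / r : ℝ) : ℂ)) ((-2 / r ^ 2 : ℝ) : ℂ) r := by
      have := (hasDerivAt_inv hr.ne').const_mul 2
      simp only [← div_eq_mul_inv] at this
      refine (this.congr_deriv ?_).ofReal_comp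
      field_simp
    have d2 : HasDerivAt (fun r : ℝ => ((r / 2 : ℝ) : ℂ)) ((1 / 2 : ℝ) : ℂ) r :=
      ((hasDerivAt_id' r).div_const 2).ofReal_comp
    refine (((d1.neg.mul (hdz r hr)).add (d2.mul (hdz r hr))).add
      ((h.deriv_y r).const_mul (κ - 1 / 2))).congr_deriv ?_
    have e : y₁ r = z r - ((r / 2 : ℝ) : ℂ) * y r := by simp only [hz]; ring
    rw [e]
    simp only [hS, Pi.neg_apply]
    push_cast
    field_simp
    ring
  refine ⟨fun r hr => ?_, hdS, h.integrableOn_of_le (by fun_prop) hzle,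
    h.integrableOn_of_le (fun r hr => (hdS r hr).continuousAt.continuousWithinAt) hSle, ?_,
    h.tendsto_of_le hSle hzle⟩
  · refine (hdz r hr).congr_deriv ?_
    simp only [hS]
    push_cast
    ring
  · simpa only [sq] using h.tendsto_of_le hzle hzle

variable {r₀ : ℝ}

theorem continuousOn_coeff {a : ℂ} {b : ℝ} :
    ContinuousOn (fun r : ℝ => a + ((b * profile (r ^ 2) : ℝ) : ℂ) * Complex.I) (Ioi 0) := by
  have := continuousOn_profile_sq
  fun_prop

theorem norm_coeff_le {a : ℂ} {b : ℝ} {r : ℝ} (hr : 0 < r) :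
    ‖a + ((b * profile (r ^ 2) : ℝ) : ℂ) * Complex.I‖ ≤ ‖a‖ + |b| := by
  refine (norm_add_le _ _).trans ?_
  rw [norm_mul, Complex.norm_I, mul_one, Complex.norm_real, norm_eq_abs, abs_mul,
    abs_of_nonneg (profile_nonneg (by positivity : 0 < r ^ 2))]
  gcongr
  exact mul_le_of_le_one_right (abs_nonneg _) (profile_le_one (by positivity))

theorem re_le_of_ne_zero (h : RadialMode m β κ y y₁ y₂) (hm : m ≠ 0) (hr : 0 < r₀)
    (hy : y r₀ ≠ 0) : κ.re ≤ -((|(m : ℝ)| - 1) / 2) := by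
  have := (h.radialSystem_of_ne_zero hm).re_nonpos_of_re_eq continuousOn_coeff
    (fun r hr => norm_coeff_le hr) (c := κ.re + (|(m : ℝ)| - 1) / 2) (fun r _ => by simp) hr hy
  linarith

theorem re_nonpos_of_ne_zero (h : RadialMode m β κ y y₁ y₂) (hm : m ≠ 0) (hr : 0 < r₀)
    (hy : y r₀ ≠ 0) : κ.re ≤ 0 := by
  have h1 := h.re_le_of_ne_zero hm hr hy
  have h2 : (1 : ℝ) ≤ |(m : ℝ)| := by
    rw [← Int.cast_abs]
    exact_mod_cast Int.one_le_abs hm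
  linarith

theorem re_le_neg_min (h : RadialMode m β κ y y₁ y₂) (hβ : β ≠ 0) (hm : m ≠ 0) (hr : 0 < r₀)
    (hy : y r₀ ≠ 0) : κ.re ≤ -min (1 / 2) (gap β) := by
  by_cases hm1 : |m| = 1
  · have hm1' : |(m : ℝ)| = 1 := by exact_mod_cast hm1
    have hs := h.radialSystem_of_ne_zero hm
    rw [hm1'] at hs
    have hm' : (m : ℝ) ≠ 0 := by exact_mod_cast hm
    have := hs.re_le_neg_gap (κ := κ) (β := β * m) (mul_ne_zero hβ hm') (fun r _ => by simp) hr hy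
    have e : gap (β * m) = gap β := by rw [gap, gap, abs_mul, hm1', mul_one]
    rw [e] at this
    exact this.trans (neg_le_neg (min_le_right _ _))
  · have h2 : 2 ≤ |m| := by
      have := Int.one_le_abs hm
      omega
    have h2' : (2 : ℝ) ≤ |(m : ℝ)| := by exact_mod_cast h2
    have h1 := h.re_le_of_ne_zero hm hr hy
    have := min_le_left (1 / 2) (gap β)
    linarith

theorem re_le_half_of_zero (h : RadialMode 0 β κ y y₁ y₂) (hr : 0 < r₀) (hy : y r₀ ≠ 0) :
    κ.re ≤ 1 / 2 := by
  have := h.radialSystem_zero.re_nonpos_of_re_eq continuousOn_const (fun r _ => le_rfl)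
    (c := κ.re - 1 / 2) (fun r _ => by simp) hr hy
  linarith

theorem re_le_or_eq_gaussian (h : RadialMode 0 β κ y y₁ y₂) :
    κ.re ≤ -(1 / 2) ∨ ∃ c : ℂ, ∀ r : ℝ, 0 < r → y r = c * exp (-r ^ 2 / 4) := by
  by_cases hz : ∀ r : ℝ, 0 < r → y₁ r + ((r / 2 : ℝ) : ℂ) * y r = 0
  · right
    have hd : ∀ r ∈ Ioi (0 : ℝ), HasDerivAt (fun r : ℝ => (exp (r ^ 2 / 4) : ℂ) * y r) 0 r := by
      intro r hr
      have d1 := (((hasDerivAt_pow 2 r).div_const 4).exp).ofReal_comp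
      refine (d1.mul (h.deriv_y r)).congr_deriv ?_
      have := hz r hr
      push_cast at this ⊢
      linear_combination Complex.exp ((r : ℂ) ^ 2 / 4) * this
    refine ⟨(exp (1 ^ 2 / 4) : ℂ) * y 1, fun r hr => ?_⟩
    have := isOpen_Ioi.is_const_of_deriv_eq_zero (convex_Ioi (0 : ℝ)).isPreconnected
      (fun r hr => (hd r hr).differentiableAt.differentiableWithinAt)
      (fun r hr => (hd r hr).deriv) (mem_Ioi.2 one_pos) hr
    rw [this, mul_right_comm, ← Complex.ofReal_mul, ← exp_add]
    rw [show r ^ 2 / 4 + -r ^ 2 / 4 = 0 by ring]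
    simp
  · left
    push Not at hz
    obtain ⟨r, hr, hne⟩ := hz
    have := h.radialSystem_one_of_zero.re_nonpos_of_re_eq continuousOn_const (fun r _ => le_rfl)
      (c := κ.re + 1 / 2) (fun r _ => by simp) hr hne
    linarith

end RadialMode

section Polar

/-- The point of the plane with polar coordinates `(r, θ)`. -/
def polar (r θ : ℝ) : R2 := v2 (r * cos θ) (r * sin θ)

@[simp] theorem v2_zero (a b : ℝ) : v2 a b 0 = a := rfl

@[simp] theorem v2_one (a b : ℝ) : v2 a b 1 = b := rfl

theorem v2_eq (a b : ℝ) : v2 a b = a • e2 0 + b • e2 1 := by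
  ext i
  fin_cases i <;> simp [e2]

theorem v2_eta (ξ : R2) : v2 (ξ 0) (ξ 1) = ξ := by
  ext i
  fin_cases i <;> rfl

theorem norm_sq_eq (ξ : R2) : ‖ξ‖ ^ 2 = ξ 0 ^ 2 + ξ 1 ^ 2 := by
  simp [EuclideanSpace.norm_sq_eq]

theorem norm_polar_sq (r θ : ℝ) : ‖polar r θ‖ ^ 2 = r ^ 2 := by
  rw [norm_sq_eq]
  simp only [polar, v2_zero, v2_one]
  linear_combination r ^ 2 * sin_sq_add_cos_sq θ

theorem polar_ne_zero {r : ℝ} (hr : 0 < r) (θ : ℝ) : polar r θ ≠ 0 := by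
  intro h
  have := norm_polar_sq r θ
  rw [h, norm_zero] at this
  nlinarith

theorem exists_polar (ξ : R2) : ∃ r θ : ℝ, 0 ≤ r ∧ θ ∈ Ioc (-π) π ∧ polar r θ = ξ := by
  refine ⟨‖(⟨ξ 0, ξ 1⟩ : ℂ)‖, Complex.arg ⟨ξ 0, ξ 1⟩, norm_nonneg _, Complex.arg_mem_Ioc _, ?_⟩
  rw [polar, Complex.norm_mul_cos_arg, Complex.norm_mul_sin_arg]
  exact v2_eta ξ

theorem hasDerivAt_v2 {a b : ℝ → ℝ} {a' b' t : ℝ} (ha : HasDerivAt a a' t)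
    (hb : HasDerivAt b b' t) : HasDerivAt (fun t => v2 (a t) (b t)) (v2 a' b') t := by
  simp only [v2_eq]
  exact (ha.smul_const (e2 0)).add (hb.smul_const (e2 1))

@[fun_prop]
theorem continuous_v2 {X : Type*} [TopologicalSpace X] {a b : X → ℝ} (ha : Continuous a)
    (hb : Continuous b) : Continuous fun x => v2 (a x) (b x) := by
  simp only [v2_eq]
  fun_prop

@[fun_prop]
theorem continuous_polar {X : Type*} [TopologicalSpace X] {a b : X → ℝ} (ha : Continuous a)
    (hb : Continuous b) : Continuous fun x => polar (a x) (b x) := by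
  unfold polar
  fun_prop

/-- Partial derivatives on the plane. -/
def pd {E : Type*} [NormedAddCommGroup E] [NormedSpace ℝ E] (i : Fin 2) (w : R2 → E) (ξ : R2) : E :=
  fderiv ℝ w ξ (e2 i)

variable {E : Type*} [NormedAddCommGroup E] [NormedSpace ℝ E]

theorem fderiv_v2 (w : R2 → E) (ξ : R2) (a b : ℝ) :
    fderiv ℝ w ξ (v2 a b) = a • pd 0 w ξ + b • pd 1 w ξ := by
  rw [v2_eq, map_add, map_smul, map_smul]
  rfl

theorem contDiff_pd {w : R2 → E} (hw : ContDiff ℝ (⊤ : ℕ∞) w) (i : Fin 2) :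
    ContDiff ℝ (⊤ : ℕ∞) (pd i w) :=
  (hw.fderiv_right (m := (⊤ : ℕ∞)) (by simp)).clm_apply contDiff_const

theorem pd_comm {w : R2 → E} (hw : ContDiff ℝ (⊤ : ℕ∞) w) (ξ : R2) :
    pd 1 (pd 0 w) ξ = pd 0 (pd 1 w) ξ := by
  have hd : DifferentiableAt ℝ (fderiv ℝ w) ξ :=
    ((hw.fderiv_right (m := (⊤ : ℕ∞)) (by simp)).differentiable (by simp)) ξ
  have hs : IsSymmSndFDerivAt ℝ w ξ :=
    (hw.contDiffAt).isSymmSndFDerivAt (by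
      rw [minSmoothness_of_isRCLikeNormedField]
      exact WithTop.coe_le_coe.2 (le_top : (2 : ℕ∞) ≤ ⊤))
  have h : ∀ i j : Fin 2, pd i (pd j w) ξ = fderiv ℝ (fderiv ℝ w) ξ (e2 i) (e2 j) := by
    intro i j
    have := (hd.hasFDerivAt.clm_apply (hasFDerivAt_const (e2 j) ξ)).fderiv
    unfold pd
    rw [this]
    simp
  rw [h, h]
  exact hs _ _

theorem hasDerivAt_comp_v2 {w : R2 → E} {a b : ℝ → ℝ} {a' b' t : ℝ}
    (hw : DifferentiableAt ℝ w (v2 (a t) (b t))) (ha : HasDerivAt a a' t) (hb : HasDerivAt b b' t) :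
    HasDerivAt (fun t => w (v2 (a t) (b t)))
      (a' • pd 0 w (v2 (a t) (b t)) + b' • pd 1 w (v2 (a t) (b t))) t := by
  have := hw.hasFDerivAt.comp_hasDerivAt t (hasDerivAt_v2 ha hb)
  rwa [fderiv_v2] at this

theorem hasDerivAt_radial {w : R2 → ℂ} (hw : Differentiable ℝ w) (r θ : ℝ) :
    HasDerivAt (fun r => w (polar r θ))
      (cos θ * pd 0 w (polar r θ) + sin θ * pd 1 w (polar r θ)) r := by
  have := hasDerivAt_comp_v2 (hw (v2 (r * cos θ) (r * sin θ))) (hasDerivAt_mul_const (cos θ))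
    (hasDerivAt_mul_const (sin θ))
  refine this.congr_deriv ?_
  simp only [Complex.real_smul, polar]

theorem hasDerivAt_angular {w : R2 → ℂ} (hw : Differentiable ℝ w) (r θ : ℝ) :
    HasDerivAt (fun θ => w (polar r θ))
      (r * (cos θ * pd 1 w (polar r θ) - sin θ * pd 0 w (polar r θ))) θ := by
  have := hasDerivAt_comp_v2 (hw (v2 (r * cos θ) (r * sin θ))) ((hasDerivAt_cos θ).const_mul r)
    ((hasDerivAt_sin θ).const_mul r)
  refine this.congr_deriv ?_
  simp only [Complex.real_smul, polar]
  push_cast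
  ring

theorem polar_pi (r : ℝ) : polar r π = polar r (-π) := by simp [polar]

theorem hasDerivAt_integral_param {F F' : ℝ → ℝ → ℂ} {a b : ℝ}
    (hF : ∀ r, Continuous (F r)) (hF' : Continuous (Function.uncurry F'))
    (hd : ∀ r θ, HasDerivAt (fun r => F r θ) (F' r θ) r) (r : ℝ) :
    HasDerivAt (fun r => ∫ θ in a..b, F r θ) (∫ θ in a..b, F' r θ) r := by
  have hK : IsCompact (Metric.closedBall r 1 ×ˢ uIcc a b) :=
    (isCompact_closedBall r 1).prod isCompact_uIcc
  obtain ⟨C, hC⟩ := hK.exists_bound_of_continuousOn hF'.continuousOn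
  have hF'r : Continuous (F' r) := hF'.comp (by fun_prop : Continuous fun θ : ℝ => (r, θ))
  refine (intervalIntegral.hasDerivAt_integral_of_dominated_loc_of_deriv_le
    (bound := fun _ => C) (Metric.closedBall_mem_nhds r one_pos)
    (Eventually.of_forall fun x => (hF x).aestronglyMeasurable) ((hF r).intervalIntegrable _ _)
    hF'r.aestronglyMeasurable (Eventually.of_forall fun t ht x hx => ?_)
    (continuous_const.intervalIntegrable _ _) (Eventually.of_forall fun t _ x _ => hd x t)).2
  exact hC (x, t) ⟨hx, uIoc_subset_uIcc ht⟩

theorem integral_mul_deriv_periodic {h h' g g' : ℝ → ℂ} (hh : ∀ θ, HasDerivAt h (h' θ) θ)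
    (hg : ∀ θ, HasDerivAt g (g' θ) θ) (ch : Continuous h') (cg : Continuous g')
    (ph : h π = h (-π)) (pg : g π = g (-π)) :
    ∫ θ in (-π)..π, h θ * g' θ = -∫ θ in (-π)..π, h' θ * g θ := by
  rw [intervalIntegral.integral_mul_deriv_eq_deriv_mul (fun x _ => hh x) (fun x _ => hg x)
    (ch.intervalIntegrable _ _) (cg.intervalIntegrable _ _), ph, pg]
  ring

theorem norm_integral_sq_le {h g : ℝ → ℂ} (hh : ∀ θ, ‖h θ‖ ≤ 1) (ch : Continuous h)
    (cg : Continuous g) :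
    ‖∫ θ in (-π)..π, h θ * g θ‖ ^ 2 ≤ 2 * π * ∫ θ in (-π)..π, ‖g θ‖ ^ 2 := by
  have hπ : -π ≤ π := by linarith [pi_pos]
  set A := ∫ θ in (-π)..π, ‖g θ‖ with hA
  have h1 : ‖∫ θ in (-π)..π, h θ * g θ‖ ≤ A := by
    refine (intervalIntegral.norm_integral_le_integral_norm hπ).trans ?_
    refine intervalIntegral.integral_mono_on hπ (Continuous.intervalIntegrable (by fun_prop) _ _)
      (Continuous.intervalIntegrable (by fun_prop) _ _) fun θ _ => ?_
    rw [norm_mul]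
    exact mul_le_of_le_one_left (norm_nonneg _) (hh θ)
  have h2 : 0 ≤ ∫ θ in (-π)..π, (‖g θ‖ - A / (2 * π)) ^ 2 :=
    intervalIntegral.integral_nonneg hπ fun θ _ => sq_nonneg _
  have h3 : ∫ θ in (-π)..π, (‖g θ‖ - A / (2 * π)) ^ 2
      = (∫ θ in (-π)..π, ‖g θ‖ ^ 2) - A ^ 2 / (2 * π) := by
    have e : ∀ θ, (‖g θ‖ - A / (2 * π)) ^ 2
        = ‖g θ‖ ^ 2 - (A / π) * ‖g θ‖ + (A / (2 * π)) ^ 2 := fun θ => by ring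
    simp only [e]
    rw [intervalIntegral.integral_add (Continuous.intervalIntegrable (by fun_prop) _ _)
      (Continuous.intervalIntegrable (by fun_prop) _ _), intervalIntegral.integral_sub
      (Continuous.intervalIntegrable (by fun_prop) _ _)
      (Continuous.intervalIntegrable (by fun_prop) _ _), intervalIntegral.integral_const_mul,
      intervalIntegral.integral_const, ← hA, smul_eq_mul]
    field_simp
    ring
  rw [h3, sub_nonneg, div_le_iff₀ (by positivity)] at h2
  calc _ ≤ A ^ 2 := pow_le_pow_left₀ (norm_nonneg _) h1 2
    _ ≤ _ := by linarith

theorem integrableOn_polar {G : R2 → ℝ} (hG : Continuous G) (h0 : ∀ ξ, 0 ≤ G ξ)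
    (hi : Integrable G) : IntegrableOn (fun r => r * ∫ θ in (-π)..π, G (polar r θ)) (Ioi 0) := by
  have hmp : MeasurePreserving (fun p : ℝ × ℝ => v2 p.1 p.2) := by
    have h1 := (EuclideanSpace.volume_preserving_symm_measurableEquiv_toLp (Fin 2)).symm
    have h2 := (volume_preserving_finTwoArrow ℝ).symm
    exact h1.comp h2
  have hi2 : Integrable (fun p : ℝ × ℝ => G (v2 p.1 p.2)) :=
    hmp.integrable_comp_of_integrable hi
  have hl := lintegral_comp_polarCoord_symm (fun p : ℝ × ℝ => ENNReal.ofReal (G (v2 p.1 p.2)))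
  have hfin : ∫⁻ p : ℝ × ℝ, ENNReal.ofReal (G (v2 p.1 p.2)) < ⊤ := by
    have := hi2.lintegral_lt_top
    exact this
  rw [← hl] at hfin
  have hint : IntegrableOn (fun p : ℝ × ℝ => p.1 * G (polar p.1 p.2))
      (Ioi (0 : ℝ) ×ˢ Ioo (-π) π) := by
    refine ⟨Continuous.aestronglyMeasurable (by fun_prop), ?_⟩
    rw [hasFiniteIntegral_iff_norm]
    refine lt_of_eq_of_lt (setLIntegral_congr_fun
      (measurableSet_Ioi.prod measurableSet_Ioo) ?_) hfin
    intro p hp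
    have : (0 : ℝ) < p.1 := hp.1
    simp only [smul_eq_mul, polarCoord_symm_apply]
    rw [norm_of_nonneg (mul_nonneg this.le (h0 _)), ENNReal.ofReal_mul this.le]
    rfl
  rw [IntegrableOn, Measure.volume_eq_prod, ← Measure.prod_restrict] at hint
  have := hint.integral_prod_left
  refine this.congr (Eventually.of_forall fun r => ?_)
  simp only
  rw [integral_const_mul, intervalIntegral.integral_of_le (by linarith [pi_pos]),
    integral_Ioc_eq_integral_Ioo]

end Polar

section Modes

/-- Continuous functions all of whose polynomial multiples lie in the Gaussian-weighted `L²`. -/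
structure GaussL2 (u : R2 → ℂ) : Prop where
  continuous : Continuous u
  integrable : ∀ k : ℕ, Integrable fun ξ => ‖ξ‖ ^ (2 * k) * ‖u ξ‖ ^ 2 * exp (‖ξ‖ ^ 2 / 4)

namespace GaussL2

variable {u v : R2 → ℂ}

theorem of_norm_sq_le (hv : Continuous v) {H : R2 → ℝ}
    (hH : ∀ k : ℕ, Integrable fun ξ => ‖ξ‖ ^ (2 * k) * H ξ * exp (‖ξ‖ ^ 2 / 4))
    (h : ∀ ξ, ‖v ξ‖ ^ 2 ≤ H ξ) : GaussL2 v := by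
  refine ⟨hv, fun k => (hH k).mono' (Continuous.aestronglyMeasurable (by fun_prop))
    (Eventually.of_forall fun ξ => ?_)⟩
  rw [norm_of_nonneg (by positivity)]
  gcongr
  exact h ξ

theorem add (hu : GaussL2 u) (hv : GaussL2 v) : GaussL2 fun ξ => u ξ + v ξ := by
  refine of_norm_sq_le (hu.continuous.add hv.continuous)
    (H := fun ξ => 2 * (‖u ξ‖ ^ 2 + ‖v ξ‖ ^ 2)) (fun k => ?_) fun ξ => ?_
  · exact (((hu.integrable k).add (hv.integrable k)).const_mul 2).congr
      (Eventually.of_forall fun ξ => by simp only [Pi.add_apply]; ring)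
  · have := pow_le_pow_left₀ (norm_nonneg _) (norm_add_le (u ξ) (v ξ)) 2
    nlinarith [sq_nonneg (‖u ξ‖ - ‖v ξ‖)]

theorem const_mul (hu : GaussL2 u) (c : ℂ) : GaussL2 fun ξ => c * u ξ :=
  of_norm_sq_le (continuous_const.mul hu.continuous) (H := fun ξ => ‖c‖ ^ 2 * ‖u ξ‖ ^ 2)
    (fun k => ((hu.integrable k).const_mul (‖c‖ ^ 2)).congr
      (Eventually.of_forall fun ξ => by ring)) fun ξ => by rw [norm_mul, mul_pow]

theorem coord_mul (hu : GaussL2 u) (i : Fin 2) : GaussL2 fun ξ => (ξ i : ℂ) * u ξ := by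
  have := hu.continuous
  refine of_norm_sq_le (by fun_prop) (H := fun ξ => ‖ξ‖ ^ 2 * ‖u ξ‖ ^ 2)
    (fun k => (hu.integrable (k + 1)).congr (Eventually.of_forall fun ξ => by ring)) fun ξ => ?_
  rw [norm_mul, mul_pow, Complex.norm_real]
  gcongr
  exact PiLp.norm_apply_le ξ i

theorem integrable_weight (hu : GaussL2 u) :
    Integrable fun ξ => exp (‖ξ‖ ^ 2 / 4) * (1 + ‖ξ‖ ^ 2) ^ 2 * ‖u ξ‖ ^ 2 := by
  refine (((hu.integrable 0).add ((hu.integrable 1).const_mul 2)).add (hu.integrable 2)).congr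
    (Eventually.of_forall fun ξ => ?_)
  simp only [Pi.add_apply]
  ring

end GaussL2

/-- Angular character. -/
def angular (m : ℤ) (θ : ℝ) : ℂ := Complex.exp (-(m * θ * Complex.I))

theorem norm_angular (m : ℤ) (θ : ℝ) : ‖angular m θ‖ = 1 := by
  rw [angular, Complex.norm_exp]
  simp

@[fun_prop]
theorem continuous_angular (m : ℤ) : Continuous (angular m) := by
  unfold angular
  fun_prop

theorem hasDerivAt_angular_char (m : ℤ) (θ : ℝ) :
    HasDerivAt (angular m) (-(m * Complex.I) * angular m θ) θ := by
  have h1 : HasDerivAt (fun t : ℝ => -((m : ℂ) * (t : ℂ) * Complex.I)) (-(m * Complex.I)) θ := by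
    have := (((hasDerivAt_id' (θ : ℝ)).ofReal_comp.const_mul (m : ℂ)).mul_const Complex.I).neg
    exact this.congr_deriv (by simp)
  refine h1.cexp.congr_deriv ?_
  simp only [angular]
  ring

theorem angular_pi (m : ℤ) : angular m π = angular m (-π) := by
  rw [angular, angular, Complex.exp_eq_exp_iff_exists_int]
  exact ⟨-m, by push_cast; ring⟩

/-- Angular Fourier coefficient of a function on the plane, as a function of the radius. -/
def mode (m : ℤ) (w : R2 → ℂ) (r : ℝ) : ℂ := ∫ θ in (-π)..π, angular m θ * w (polar r θ)

/-- Integrand of the second radial derivative. -/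
def radial₂ (w : R2 → ℂ) (r θ : ℝ) : ℂ :=
  cos θ * (cos θ * pd 0 (pd 0 w) (polar r θ) + sin θ * pd 1 (pd 0 w) (polar r θ))
    + sin θ * (cos θ * pd 0 (pd 1 w) (polar r θ) + sin θ * pd 1 (pd 1 w) (polar r θ))

theorem angular_integral_comb (m : ℤ) {g₁ g₂ g₃ g₄ g₅ : ℝ → ℂ} (h₁ : Continuous g₁)
    (h₂ : Continuous g₂) (h₃ : Continuous g₃) (h₄ : Continuous g₄) (h₅ : Continuous g₅)
    (c₁ c₂ c₃ c₄ c₅ : ℂ)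
    (h : ∀ θ, c₁ * g₁ θ + c₂ * g₂ θ + c₃ * g₃ θ + c₄ * g₄ θ + c₅ * g₅ θ = 0) :
    c₁ * (∫ θ in (-π)..π, angular m θ * g₁ θ) + c₂ * (∫ θ in (-π)..π, angular m θ * g₂ θ)
      + c₃ * (∫ θ in (-π)..π, angular m θ * g₃ θ) + c₄ * (∫ θ in (-π)..π, angular m θ * g₄ θ)
      + c₅ * (∫ θ in (-π)..π, angular m θ * g₅ θ) = 0 := by
  simp only [← intervalIntegral.integral_const_mul]
  rw [← intervalIntegral.integral_add, ← intervalIntegral.integral_add,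
    ← intervalIntegral.integral_add, ← intervalIntegral.integral_add]
  · rw [← intervalIntegral.integral_zero (a := -π) (b := π)]
    refine intervalIntegral.integral_congr fun θ _ => ?_
    linear_combination angular m θ * h θ
  all_goals exact Continuous.intervalIntegrable (by fun_prop) _ _

theorem angular_integral_by_parts (m : ℤ) {g g' : ℝ → ℂ} (hg : ∀ θ, HasDerivAt g (g' θ) θ)
    (cg : Continuous g') (pg : g π = g (-π)) :
    ∫ θ in (-π)..π, angular m θ * g' θ = m * Complex.I * ∫ θ in (-π)..π, angular m θ * g θ := by
  rw [integral_mul_deriv_periodic (hasDerivAt_angular_char m) hg (by fun_prop) cg (angular_pi m) pg,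
    ← intervalIntegral.integral_neg, ← intervalIntegral.integral_const_mul]
  refine intervalIntegral.integral_congr fun θ _ => ?_
  ring

theorem hasDerivAt_mode (m : ℤ) {w : R2 → ℂ} (hw : ContDiff ℝ (⊤ : ℕ∞) w) (r : ℝ) :
    HasDerivAt (mode m w) (∫ θ in (-π)..π, angular m θ *
      (cos θ * pd 0 w (polar r θ) + sin θ * pd 1 w (polar r θ))) r := by
  have c0 := (contDiff_pd hw 0).continuous
  have c1 := (contDiff_pd hw 1).continuous
  have cw := hw.continuous
  exact hasDerivAt_integral_param (F' := fun r θ => angular m θ *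
      (cos θ * pd 0 w (polar r θ) + sin θ * pd 1 w (polar r θ))) (by fun_prop)
      (by simp only [Function.uncurry_def]; fun_prop)
    (fun r θ => (hasDerivAt_radial (hw.differentiable (by simp)) r θ).const_mul _) r

/-- Integrand of the first radial derivative. -/
def radial₁ (w : R2 → ℂ) (r θ : ℝ) : ℂ :=
  cos θ * pd 0 w (polar r θ) + sin θ * pd 1 w (polar r θ)

theorem continuous_radial₁ {w : R2 → ℂ} (hw : ContDiff ℝ (⊤ : ℕ∞) w) :
    Continuous (Function.uncurry (radial₁ w)) := by
  have c0 := (contDiff_pd hw 0).continuous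
  have c1 := (contDiff_pd hw 1).continuous
  unfold radial₁
  simp only [Function.uncurry_def]
  fun_prop

theorem continuous_radial₂ {w : R2 → ℂ} (hw : ContDiff ℝ (⊤ : ℕ∞) w) :
    Continuous (Function.uncurry (radial₂ w)) := by
  have c00 := (contDiff_pd (contDiff_pd hw 0) 0).continuous
  have c10 := (contDiff_pd (contDiff_pd hw 0) 1).continuous
  have c01 := (contDiff_pd (contDiff_pd hw 1) 0).continuous
  have c11 := (contDiff_pd (contDiff_pd hw 1) 1).continuous
  unfold radial₂
  simp only [Function.uncurry_def]
  fun_prop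

theorem continuous_radial₁_angle {w : R2 → ℂ} (hw : ContDiff ℝ (⊤ : ℕ∞) w) (r : ℝ) :
    Continuous (radial₁ w r) :=
  (continuous_radial₁ hw).uncurry_left r

theorem continuous_radial₂_angle {w : R2 → ℂ} (hw : ContDiff ℝ (⊤ : ℕ∞) w) (r : ℝ) :
    Continuous (radial₂ w r) :=
  (continuous_radial₂ hw).uncurry_left r

theorem hasDerivAt_radial₁ {w : R2 → ℂ} (hw : ContDiff ℝ (⊤ : ℕ∞) w) (r θ : ℝ) :
    HasDerivAt (fun r => radial₁ w r θ) (radial₂ w r θ) r := by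
  have hd0 : Differentiable ℝ (pd 0 w) := (contDiff_pd hw 0).differentiable (by simp)
  have hd1 : Differentiable ℝ (pd 1 w) := (contDiff_pd hw 1).differentiable (by simp)
  exact ((hasDerivAt_radial hd0 r θ).const_mul _).add ((hasDerivAt_radial hd1 r θ).const_mul _)

theorem hasDerivAt_mode₁ (m : ℤ) {w : R2 → ℂ} (hw : ContDiff ℝ (⊤ : ℕ∞) w) (r : ℝ) :
    HasDerivAt (fun r => ∫ θ in (-π)..π, angular m θ * radial₁ w r θ)
      (∫ θ in (-π)..π, angular m θ * radial₂ w r θ) r := by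
  have cr := continuous_radial₂ hw
  have h1 : ∀ r, Continuous fun θ => angular m θ * radial₁ w r θ := fun r =>
    (continuous_angular m).mul (continuous_radial₁_angle hw r)
  have h2 : Continuous (Function.uncurry fun r θ => angular m θ * radial₂ w r θ) := by
    simp only [Function.uncurry_def] at cr ⊢
    fun_prop
  exact hasDerivAt_integral_param h1 h2
    (fun r θ => (hasDerivAt_radial₁ hw r θ).const_mul (angular m θ)) r

theorem continuous_mode₂ (m : ℤ) {w : R2 → ℂ} (hw : ContDiff ℝ (⊤ : ℕ∞) w) :
    Continuous fun r => ∫ θ in (-π)..π, angular m θ * radial₂ w r θ := by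
  have cr := continuous_radial₂ hw
  refine intervalIntegral.continuous_parametric_intervalIntegral_of_continuous' ?_ _ _
  simp only [Function.uncurry_def] at cr ⊢
  fun_prop

theorem radial_norm_sq_le (w : R2 → ℂ) (r θ : ℝ) :
    ‖w (polar r θ)‖ ^ 2 + ‖radial₁ w r θ‖ ^ 2 + ‖radial₂ w r θ‖ ^ 2 ≤
      ‖w (polar r θ)‖ ^ 2 + 2 * (‖pd 0 w (polar r θ)‖ ^ 2 + ‖pd 1 w (polar r θ)‖ ^ 2)
      + 4 * (‖pd 0 (pd 0 w) (polar r θ)‖ ^ 2 + ‖pd 1 (pd 0 w) (polar r θ)‖ ^ 2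
      + ‖pd 0 (pd 1 w) (polar r θ)‖ ^ 2 + ‖pd 1 (pd 1 w) (polar r θ)‖ ^ 2) := by
  have cs : ∀ a b : ℂ, ‖cos θ * a + sin θ * b‖ ^ 2 ≤ 2 * (‖a‖ ^ 2 + ‖b‖ ^ 2) := by
    intro a b
    have h1 : ‖cos θ * a + sin θ * b‖ ≤ ‖a‖ + ‖b‖ := by
      refine (norm_add_le _ _).trans (add_le_add ?_ ?_) <;>
      · rw [norm_mul, Complex.norm_real]
        refine mul_le_of_le_one_left (norm_nonneg _) ?_
        first | exact abs_cos_le_one θ | exact abs_sin_le_one θ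
    have h2 := pow_le_pow_left₀ (norm_nonneg _) h1 2
    nlinarith [sq_nonneg (‖a‖ - ‖b‖)]
  have k1 := cs (pd 0 w (polar r θ)) (pd 1 w (polar r θ))
  have k2 := cs (cos θ * pd 0 (pd 0 w) (polar r θ) + sin θ * pd 1 (pd 0 w) (polar r θ))
    (cos θ * pd 0 (pd 1 w) (polar r θ) + sin θ * pd 1 (pd 1 w) (polar r θ))
  have k3 := cs (pd 0 (pd 0 w) (polar r θ)) (pd 1 (pd 0 w) (polar r θ))
  have k4 := cs (pd 0 (pd 1 w) (polar r θ)) (pd 1 (pd 1 w) (polar r θ))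
  unfold radial₁ radial₂
  linarith

theorem integrableOn_mode (m : ℤ) {w : R2 → ℂ} (hw : ContDiff ℝ (⊤ : ℕ∞) w)
    (g0 : GaussL2 w) (g1 : ∀ i, GaussL2 (pd i w)) (g2 : ∀ i j, GaussL2 (pd i (pd j w))) :
    IntegrableOn (fun r => r * exp (r ^ 2 / 4) * ((1 + r ^ 2) ^ 2 * (‖mode m w r‖ ^ 2
      + ‖∫ θ in (-π)..π, angular m θ * radial₁ w r θ‖ ^ 2
      + ‖∫ θ in (-π)..π, angular m θ * radial₂ w r θ‖ ^ 2))) (Ioi 0) := by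
  have cw := hw.continuous
  have c0 := (contDiff_pd hw 0).continuous
  have c1 := (contDiff_pd hw 1).continuous
  have c00 := (contDiff_pd (contDiff_pd hw 0) 0).continuous
  have c10 := (contDiff_pd (contDiff_pd hw 0) 1).continuous
  have c01 := (contDiff_pd (contDiff_pd hw 1) 0).continuous
  have c11 := (contDiff_pd (contDiff_pd hw 1) 1).continuous
  have cr' : ∀ r, Continuous (radial₂ w r) := continuous_radial₂_angle hw
  have cr₁ : ∀ r, Continuous (radial₁ w r) := continuous_radial₁_angle hw
  set G : R2 → ℝ := fun ξ => exp (‖ξ‖ ^ 2 / 4) * (1 + ‖ξ‖ ^ 2) ^ 2 * (‖w ξ‖ ^ 2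
    + 2 * (‖pd 0 w ξ‖ ^ 2 + ‖pd 1 w ξ‖ ^ 2) + 4 * (‖pd 0 (pd 0 w) ξ‖ ^ 2
    + ‖pd 1 (pd 0 w) ξ‖ ^ 2 + ‖pd 0 (pd 1 w) ξ‖ ^ 2 + ‖pd 1 (pd 1 w) ξ‖ ^ 2)) with hG
  have iG : Integrable G := by
    refine ((g0.integrable_weight.add (((g1 0).integrable_weight.add
      (g1 1).integrable_weight).const_mul 2)).add (((((g2 0 0).integrable_weight.add
      (g2 1 0).integrable_weight).add (g2 0 1).integrable_weight).add
      (g2 1 1).integrable_weight).const_mul 4)).congr (Eventually.of_forall fun ξ => ?_)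
    simp only [Pi.add_apply, hG]
    ring
  have cG : Continuous G := by fun_prop
  refine ((integrableOn_polar cG (fun ξ => by positivity) iG).const_mul (2 * π)).mono'
    (Continuous.aestronglyMeasurable ?_) ?_
  · have aux : ∀ a b c : ℝ → ℂ, Continuous a → Continuous b → Continuous c →
        Continuous fun r : ℝ => r * exp (r ^ 2 / 4) *
          ((1 + r ^ 2) ^ 2 * (‖a r‖ ^ 2 + ‖b r‖ ^ 2 + ‖c r‖ ^ 2)) := by
      intro a b c ha hb hc
      fun_prop
    exact aux _ _ _ (continuous_iff_continuousAt.2 fun r => (hasDerivAt_mode m hw r).continuousAt)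
      (continuous_iff_continuousAt.2 fun r => (hasDerivAt_mode₁ m hw r).continuousAt)
      (continuous_mode₂ m hw)
  · filter_upwards [ae_restrict_mem measurableSet_Ioi] with r hr
    have hr' : (0 : ℝ) < r := hr
    rw [norm_of_nonneg (by positivity)]
    have n0 := norm_integral_sq_le (fun θ => (norm_angular m θ).le) (continuous_angular m)
      (by fun_prop : Continuous fun θ => w (polar r θ))
    have n1 := norm_integral_sq_le (fun θ => (norm_angular m θ).le) (continuous_angular m) (cr₁ r)
    have n2 := norm_integral_sq_le (fun θ => (norm_angular m θ).le) (continuous_angular m)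
      (cr' r)
    have hπ : -π ≤ π := by linarith [pi_pos]
    have key : ∫ θ in (-π)..π, (‖w (polar r θ)‖ ^ 2
        + ‖radial₁ w r θ‖ ^ 2 + ‖radial₂ w r θ‖ ^ 2)
        ≤ ∫ θ in (-π)..π, (exp (r ^ 2 / 4) * (1 + r ^ 2) ^ 2)⁻¹ * G (polar r θ) := by
      refine intervalIntegral.integral_mono_on hπ (Continuous.intervalIntegrable
        (by have := cr₁ r; have := cr' r; fun_prop) _ _)
        (Continuous.intervalIntegrable (by fun_prop) _ _)
        fun θ _ => ?_
      simp only [hG, norm_polar_sq]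
      rw [inv_mul_cancel_left₀ (by positivity)]
      exact radial_norm_sq_le w r θ
    rw [intervalIntegral.integral_const_mul, intervalIntegral.integral_add
      (Continuous.intervalIntegrable (by fun_prop) _ _)
      (Continuous.intervalIntegrable (by have := cr₁ r; have := cr' r; fun_prop) _ _),
      intervalIntegral.integral_add
      (Continuous.intervalIntegrable (by fun_prop) _ _)
      (Continuous.intervalIntegrable (by have := cr₁ r; fun_prop) _ _)] at key
    have hpos : 0 < exp (r ^ 2 / 4) * (1 + r ^ 2) ^ 2 := by positivity
    rw [inv_mul_eq_div, le_div_iff₀ hpos] at key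
    have hsum := add_le_add (add_le_add n0 n1) n2
    rw [← mul_add, ← mul_add] at hsum
    unfold mode
    have k2 := mul_le_mul_of_nonneg_left hsum (mul_pos hr' hpos).le
    have k3 := mul_le_mul_of_nonneg_left key (by positivity : 0 ≤ 2 * π * r)
    linear_combination k2 + k3

theorem mode_ode {w : R2 → ℂ} {α : ℝ} {κ : ℂ} (m : ℤ) (hw : ContDiff ℝ (⊤ : ℕ∞) w)
    (heq : ∀ ξ : R2, ξ ≠ 0 → pd 0 (pd 0 w) ξ + pd 1 (pd 1 w) ξ
      + 1 / 2 * (ξ 0 * pd 0 w ξ + ξ 1 * pd 1 w ξ) + 3 / 2 * w ξ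
      - (α * profile (‖ξ‖ ^ 2) : ℝ) * (ξ 0 * pd 1 w ξ - ξ 1 * pd 0 w ξ) = κ * w ξ)
    {r : ℝ} (hr : 0 < r) :
    (r : ℂ) ^ 2 * (∫ θ in (-π)..π, angular m θ * radial₂ w r θ)
    + r * (∫ θ in (-π)..π, angular m θ * radial₁ w r θ) - (m : ℂ) ^ 2 * mode m w r
    + (r : ℂ) ^ 3 / 2 * (∫ θ in (-π)..π, angular m θ * radial₁ w r θ)
    + 3 / 2 * (r : ℂ) ^ 2 * mode m w r
    - ((α * m * profile (r ^ 2) : ℝ) : ℂ) * Complex.I * (r : ℂ) ^ 2 * mode m w r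
    = κ * (r : ℂ) ^ 2 * mode m w r := by
  have cw := hw.continuous
  have c0 := (contDiff_pd hw 0).continuous
  have c1 := (contDiff_pd hw 1).continuous
  have c00 := (contDiff_pd (contDiff_pd hw 0) 0).continuous
  have c10 := (contDiff_pd (contDiff_pd hw 0) 1).continuous
  have c01 := (contDiff_pd (contDiff_pd hw 1) 0).continuous
  have c11 := (contDiff_pd (contDiff_pd hw 1) 1).continuous
  have cr' : ∀ r, Continuous (radial₂ w r) := continuous_radial₂_angle hw
  have cr₁ : ∀ r, Continuous (radial₁ w r) := continuous_radial₁_angle hw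
  have hd0 : Differentiable ℝ (pd 0 w) := (contDiff_pd hw 0).differentiable (by simp)
  have hd1 : Differentiable ℝ (pd 1 w) := (contDiff_pd hw 1).differentiable (by simp)
  have hd : Differentiable ℝ w := hw.differentiable (by simp)
  have a1 : ∀ θ, HasDerivAt (fun θ => w (polar r θ))
      (r * (cos θ * pd 1 w (polar r θ) - sin θ * pd 0 w (polar r θ))) θ :=
    hasDerivAt_angular hd r
  set q : ℝ → ℂ := fun θ => r * (cos θ * pd 1 w (polar r θ) - sin θ * pd 0 w (polar r θ)) with hq
  set q' : ℝ → ℂ := fun θ => r * ((-(sin θ : ℂ) * pd 1 w (polar r θ) + cos θ *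
    (r * (cos θ * pd 1 (pd 1 w) (polar r θ) - sin θ * pd 0 (pd 1 w) (polar r θ))))
    - (cos θ * pd 0 w (polar r θ) + sin θ *
    (r * (cos θ * pd 1 (pd 0 w) (polar r θ) - sin θ * pd 0 (pd 0 w) (polar r θ))))) with hq'
  have a2 : ∀ θ, HasDerivAt q (q' θ) θ := by
    intro θ
    have hc := (hasDerivAt_cos θ).ofReal_comp
    have hs := (hasDerivAt_sin θ).ofReal_comp
    refine (((hc.mul (hasDerivAt_angular hd1 r θ)).sub
      (hs.mul (hasDerivAt_angular hd0 r θ))).const_mul (r : ℂ)).congr_deriv ?_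
    simp only [hq']
    push_cast
    ring
  have cq : Continuous q := by fun_prop
  have cq' : Continuous q' := by fun_prop
  have i1 := angular_integral_by_parts m a1 cq (by rw [polar_pi])
  have i2 := angular_integral_by_parts m a2 cq' (by simp only [hq, polar_pi]; simp)
  rw [i1] at i2
  have comb := angular_integral_comb m (cr' r)
    (cr₁ r)
    cq' (by fun_prop : Continuous fun θ => w (polar r θ)) cq
    ((r : ℂ) ^ 2) (r + (r : ℂ) ^ 3 / 2) 1 (3 / 2 * (r : ℂ) ^ 2 - κ * (r : ℂ) ^ 2)
    (-(α * profile (r ^ 2) : ℝ) * (r : ℂ) ^ 2) (fun θ => by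
      have := heq (polar r θ) (polar_ne_zero hr θ)
      rw [norm_polar_sq] at this
      have e0 : polar r θ 0 = r * cos θ := rfl
      have e1 : polar r θ 1 = r * sin θ := rfl
      have sc : (sin θ : ℂ) ^ 2 + (cos θ : ℂ) ^ 2 = 1 := by
        exact_mod_cast sin_sq_add_cos_sq θ
      rw [e0, e1] at this
      simp only [hq, hq', radial₁, radial₂]
      push_cast at this sc ⊢
      linear_combination (r : ℂ) ^ 2 * this + (r : ℂ) ^ 2 * (pd 0 (pd 0 w) (polar r θ)
        + pd 1 (pd 1 w) (polar r θ)) * sc)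
  rw [i1, i2] at comb
  change _ + _ + _ + _ * mode m w r + _ = 0 at comb
  have em : ∫ θ in (-π)..π, angular m θ * w (polar r θ) = mode m w r := rfl
  rw [em] at comb
  push_cast at comb ⊢
  linear_combination comb - (m : ℂ) ^ 2 * mode m w r * Complex.I_sq

/-- Decaying solutions of the scalar eigenvalue equation `Δw + ½ ξ·∇w + 3/2 w - α g·∇w = κ w`
off the origin. -/
structure ScalarEigen (α : ℝ) (κ : ℂ) (w : R2 → ℂ) : Prop where
  contDiff : ContDiff ℝ (⊤ : ℕ∞) w
  gaussL2 : GaussL2 w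
  gaussL2_pd : ∀ i, GaussL2 (pd i w)
  gaussL2_pd_pd : ∀ i j, GaussL2 (pd i (pd j w))
  eq : ∀ ξ : R2, ξ ≠ 0 → pd 0 (pd 0 w) ξ + pd 1 (pd 1 w) ξ
    + 1 / 2 * (ξ 0 * pd 0 w ξ + ξ 1 * pd 1 w ξ) + 3 / 2 * w ξ
    - (α * profile (‖ξ‖ ^ 2) : ℝ) * (ξ 0 * pd 1 w ξ - ξ 1 * pd 0 w ξ) = κ * w ξ

theorem ScalarEigen.radialMode {w : R2 → ℂ} {α : ℝ} {κ : ℂ} (h : ScalarEigen α κ w) (m : ℤ) :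
    RadialMode m α κ (mode m w)
      (fun r => ∫ θ in (-π)..π, angular m θ * radial₁ w r θ)
      (fun r => ∫ θ in (-π)..π, angular m θ * radial₂ w r θ) :=
  ⟨hasDerivAt_mode m h.contDiff, hasDerivAt_mode₁ m h.contDiff, continuous_mode₂ m h.contDiff,
    integrableOn_mode m h.contDiff h.gaussL2 h.gaussL2_pd h.gaussL2_pd_pd,
    fun _ hr => mode_ode m h.contDiff h.eq hr⟩

end Modes

section NonzeroMode

theorem exists_ne_zero_off_origin {w : R2 → ℂ} (cw : Continuous w) (h : ∃ ξ, w ξ ≠ 0) :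
    ∃ ξ, ξ ≠ 0 ∧ w ξ ≠ 0 := by
  obtain ⟨ξ, h1, h2⟩ := (dense_compl_singleton (0 : R2)).inter_open_nonempty {ξ | w ξ ≠ 0}
    (isOpen_ne_fun cw continuous_const) h
  exact ⟨ξ, h2, h1⟩

theorem exists_angular_integral_ne_zero {g : ℝ → ℂ} (cg : Continuous g)
    (h : ∃ θ ∈ Icc (-π) π, g θ ≠ 0) : ∃ m : ℤ, ∫ θ in (-π)..π, angular m θ * g θ ≠ 0 := by
  by_contra! hall
  have hπ : -π < π := by linarith [pi_pos]
  have hc : ∀ m : ℤ, fourierCoeffOn hπ g m = 0 := by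
    intro m
    rw [fourierCoeffOn_eq_integral]
    have : ∫ x in (-π)..π, fourier (-m) (x : AddCircle (π - -π)) • g x
        = ∫ θ in (-π)..π, angular m θ * g θ := by
      refine intervalIntegral.integral_congr fun x _ => ?_
      simp only [fourier_coe_apply, smul_eq_mul, angular]
      congr 2
      have : (π : ℂ) ≠ 0 := by exact_mod_cast pi_ne_zero
      push_cast
      field_simp
      ring
    rw [this, hall, smul_zero]
  have hm : MemLp g 2 (volume.restrict (Ioc (-π) π)) := by
    obtain ⟨C, hC⟩ := isCompact_Icc.exists_bound_of_continuousOn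
      (cg.continuousOn (s := Icc (-π) π))
    refine MemLp.of_bound cg.aestronglyMeasurable C ?_
    filter_upwards [ae_restrict_mem measurableSet_Ioc] with x hx
    exact hC x (Ioc_subset_Icc_self hx)
  have hs := hasSum_sq_fourierCoeffOn hπ hm
  simp only [hc, norm_zero, ne_eq, OfNat.ofNat_ne_zero, not_false_eq_true, zero_pow] at hs
  have h0 := hs.unique hasSum_zero
  obtain ⟨θ, hθ, hg⟩ := h
  have hpos : 0 < ∫ x in (-π)..π, ‖g x‖ ^ 2 :=
    intervalIntegral.integral_pos hπ (by fun_prop) (fun x _ => sq_nonneg _)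
      ⟨θ, hθ, by positivity⟩
  rw [smul_eq_mul] at h0
  have : 0 < (π - -π)⁻¹ := by
    have := pi_pos
    positivity
  nlinarith [mul_pos this hpos]

theorem exists_mode_ne_zero {w : R2 → ℂ} (cw : Continuous w) (h : ∃ ξ, w ξ ≠ 0) :
    ∃ m : ℤ, ∃ r : ℝ, 0 < r ∧ mode m w r ≠ 0 := by
  obtain ⟨ξ, h1, h2⟩ := exists_ne_zero_off_origin cw h
  obtain ⟨r, θ, hr, hθ, rfl⟩ := exists_polar ξ
  have hr' : r ≠ 0 := by
    rintro rfl
    exact h1 (by ext i; fin_cases i <;> simp [polar, v2])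
  obtain ⟨m, hm⟩ := exists_angular_integral_ne_zero (g := fun θ => w (polar r θ)) (by fun_prop)
    ⟨θ, Ioc_subset_Icc_self hθ, h2⟩
  exact ⟨m, r, lt_of_le_of_ne hr hr'.symm, hm⟩

end NonzeroMode

section ScalarBounds

variable {w : R2 → ℂ} {α : ℝ} {κ : ℂ}

theorem ScalarEigen.re_nonpos_of_mode_zero (h : ScalarEigen α κ w) (hne : ∃ ξ, w ξ ≠ 0)
    (h0 : ∀ r, mode 0 w r = 0) : κ.re ≤ 0 := by
  obtain ⟨m, r, hr, hm⟩ := exists_mode_ne_zero h.gaussL2.continuous hne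
  have hm0 : m ≠ 0 := by
    rintro rfl
    exact hm (h0 r)
  exact (h.radialMode m).re_nonpos_of_ne_zero hm0 hr hm

theorem ScalarEigen.re_le_half (h : ScalarEigen α κ w) (hne : ∃ ξ, w ξ ≠ 0) : κ.re ≤ 1 / 2 := by
  obtain ⟨m, r, hr, hm⟩ := exists_mode_ne_zero h.gaussL2.continuous hne
  by_cases hm0 : m = 0
  · subst hm0
    exact (h.radialMode 0).re_le_half_of_zero hr hm
  · linarith [(h.radialMode m).re_nonpos_of_ne_zero hm0 hr hm]

/-- The angular derivative `ξ₁ ∂₂ - ξ₂ ∂₁` has no radial mode. -/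
theorem mode_zero_rotation {v : R2 → ℂ} (hv : ContDiff ℝ (⊤ : ℕ∞) v) (r : ℝ) :
    mode 0 (fun ξ => ξ 0 * pd 1 v ξ - ξ 1 * pd 0 v ξ) r = 0 := by
  have c0 := (contDiff_pd hv 0).continuous
  have c1 := (contDiff_pd hv 1).continuous
  have h := angular_integral_by_parts 0
    (fun θ => hasDerivAt_angular (hv.differentiable (by simp)) r θ) (by fun_prop) (by rw [polar_pi])
  rw [Int.cast_zero, zero_mul, zero_mul] at h
  rw [← h]
  refine intervalIntegral.integral_congr fun θ _ => ?_
  have e0 : polar r θ 0 = r * cos θ := rfl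
  have e1 : polar r θ 1 = r * sin θ := rfl
  simp only [e0, e1]
  push_cast
  ring

/-- Flux through the circle of radius `r`. -/
def flux (f₀ f₁ : R2 → ℂ) (r : ℝ) : ℂ :=
  r * ∫ θ in (-π)..π, (cos θ * f₀ (polar r θ) + sin θ * f₁ (polar r θ))

theorem hasDerivAt_flux {f₀ f₁ : R2 → ℂ} (h₀ : ContDiff ℝ (⊤ : ℕ∞) f₀)
    (h₁ : ContDiff ℝ (⊤ : ℕ∞) f₁) (r : ℝ) :
    HasDerivAt (flux f₀ f₁) (r * mode 0 (fun ξ => pd 0 f₀ ξ + pd 1 f₁ ξ) r) r := by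
  have c₀ := h₀.continuous
  have c₁ := h₁.continuous
  have c00 := (contDiff_pd h₀ 0).continuous
  have c10 := (contDiff_pd h₀ 1).continuous
  have c01 := (contDiff_pd h₁ 0).continuous
  have c11 := (contDiff_pd h₁ 1).continuous
  have d₀ : Differentiable ℝ f₀ := h₀.differentiable (by simp)
  have d₁ : Differentiable ℝ f₁ := h₁.differentiable (by simp)
  set D : ℝ → ℝ → ℂ := fun r θ =>
    cos θ * (cos θ * pd 0 f₀ (polar r θ) + sin θ * pd 1 f₀ (polar r θ))
    + sin θ * (cos θ * pd 0 f₁ (polar r θ) + sin θ * pd 1 f₁ (polar r θ)) with hD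
  have dI : HasDerivAt
      (fun r => ∫ θ in (-π)..π, (cos θ * f₀ (polar r θ) + sin θ * f₁ (polar r θ)))
      (∫ θ in (-π)..π, D r θ) r := by
    refine hasDerivAt_integral_param
      (F := fun r θ => cos θ * f₀ (polar r θ) + sin θ * f₁ (polar r θ)) (fun r => by fun_prop)
      (by simp only [Function.uncurry_def, hD]; fun_prop) (fun r θ => ?_) r
    exact ((hasDerivAt_radial d₀ r θ).const_mul _).add ((hasDerivAt_radial d₁ r θ).const_mul _)
  set q' : ℝ → ℂ := fun θ => -(sin θ : ℂ) * f₁ (polar r θ)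
    + cos θ * (r * (cos θ * pd 1 f₁ (polar r θ) - sin θ * pd 0 f₁ (polar r θ)))
    - (cos θ * f₀ (polar r θ)
    + sin θ * (r * (cos θ * pd 1 f₀ (polar r θ) - sin θ * pd 0 f₀ (polar r θ)))) with hq'
  have hq : ∀ θ : ℝ, HasDerivAt (fun θ : ℝ => (cos θ : ℂ) * f₁ (polar r θ)
      - (sin θ : ℂ) * f₀ (polar r θ)) (q' θ) θ := by
    intro θ
    refine (((hasDerivAt_cos θ).ofReal_comp.mul (hasDerivAt_angular d₁ r θ)).sub
      ((hasDerivAt_sin θ).ofReal_comp.mul (hasDerivAt_angular d₀ r θ))).congr_deriv ?_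
    simp only [hq']
    push_cast
    ring
  have hz : ∫ θ in (-π)..π, q' θ = 0 := by
    rw [intervalIntegral.integral_eq_sub_of_hasDerivAt (fun θ _ => hq θ)
      (Continuous.intervalIntegrable (by fun_prop) _ _), polar_pi]
    simp
  have := ((hasDerivAt_id' r).ofReal_comp).mul dI
  refine this.congr_deriv ?_
  rw [← sub_zero (_ + _), ← neg_zero, ← hz]
  simp only [mode, ← intervalIntegral.integral_const_mul, Complex.ofReal_one]
  rw [sub_neg_eq_add, ← intervalIntegral.integral_add, ← intervalIntegral.integral_add]
  · refine intervalIntegral.integral_congr fun θ _ => ?_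
    have sc : (sin θ : ℂ) ^ 2 + (cos θ : ℂ) ^ 2 = 1 := by exact_mod_cast sin_sq_add_cos_sq θ
    simp only [hD, hq', angular]
    push_cast at sc ⊢
    simp only [zero_mul, neg_zero, Complex.exp_zero]
    linear_combination (r : ℂ) * (pd 0 f₀ (polar r θ) + pd 1 f₁ (polar r θ)) * sc
  all_goals exact Continuous.intervalIntegrable (by fun_prop) _ _

theorem GaussL2.integrableOn_integral {v : R2 → ℂ} (hv : GaussL2 v) {h : ℝ → ℂ}
    (hh : ∀ θ, ‖h θ‖ ≤ 1) (ch : Continuous h) :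
    IntegrableOn (fun r : ℝ => (r : ℂ) * ∫ θ in (-π)..π, h θ * v (polar r θ)) (Ioi 0) := by
  have cv := hv.continuous
  have i1 := integrableOn_polar (by fun_prop) (fun ξ => by positivity) hv.integrable_weight
  have i2 := (integrable_mul_exp_neg_mul_sq (b := 1 / 4) (by norm_num)).integrableOn (s := Ioi 0)
  refine Integrable.mono' ((i1.const_mul (2 * π)).add i2) (Continuous.aestronglyMeasurable ?_) ?_
  · refine Complex.continuous_ofReal.mul ?_
    refine intervalIntegral.continuous_parametric_intervalIntegral_of_continuous' ?_ _ _
    simp only [Function.uncurry_def]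
    fun_prop
  · filter_upwards [ae_restrict_mem measurableSet_Ioi] with r hr
    have hr' : (0 : ℝ) < r := hr
    have n := norm_integral_sq_le hh ch (by fun_prop : Continuous fun θ => v (polar r θ))
    set A := ‖∫ θ in (-π)..π, h θ * v (polar r θ)‖
    set B := ∫ θ in (-π)..π, ‖v (polar r θ)‖ ^ 2
    have hB : 0 ≤ B := intervalIntegral.integral_nonneg (by linarith [pi_pos])
      fun θ _ => sq_nonneg _
    simp only [Pi.add_apply, norm_polar_sq, intervalIntegral.integral_const_mul, norm_mul,
      Complex.norm_real, norm_of_nonneg hr'.le]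
    set E := exp (r ^ 2 / 4) with hE
    have hEi : exp (-(1 / 4) * r ^ 2) = E⁻¹ := by
      rw [hE, ← exp_neg]
      ring_nf
    have hE0 : 0 < E := exp_pos _
    have h1 : A ≤ E * A ^ 2 + E⁻¹ := by
      have : E * A ^ 2 + E⁻¹ - A = E⁻¹ * ((E * A - 1 / 2) ^ 2 + 3 / 4) := by
        field_simp
        ring
      have h2 : 0 ≤ E⁻¹ * ((E * A - 1 / 2) ^ 2 + 3 / 4) := by positivity
      linarith
    have h2 : E * A ^ 2 ≤ 2 * π * (E * (1 + r ^ 2) ^ 2 * B) := by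
      have : E * A ^ 2 ≤ E * (2 * π * B) := by gcongr
      have h3 : 1 ≤ (1 + r ^ 2) ^ 2 := by nlinarith [sq_nonneg r]
      have h4 : 0 ≤ 2 * π * E * B := by positivity
      nlinarith [mul_le_mul_of_nonneg_left h3 h4]
    rw [hEi]
    nlinarith

theorem ScalarEigen.re_le_of_divergence {f₀ f₁ : R2 → ℂ} (h₀ : ContDiff ℝ (⊤ : ℕ∞) f₀)
    (h₁ : ContDiff ℝ (⊤ : ℕ∞) f₁) (g₀ : GaussL2 f₀) (g₁ : GaussL2 f₁) (hα : α ≠ 0)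
    (h : ScalarEigen α κ fun ξ => pd 0 f₀ ξ + pd 1 f₁ ξ)
    (hne : ∃ ξ, pd 0 f₀ ξ + pd 1 f₁ ξ ≠ 0) : κ.re ≤ -min (1 / 2) (gap α) := by
  obtain ⟨m, r, hr, hm⟩ := exists_mode_ne_zero h.gaussL2.continuous hne
  by_cases hm0 : m = 0
  swap
  · exact (h.radialMode m).re_le_neg_min hα hm0 hr hm
  subst hm0
  rcases (h.radialMode 0).re_le_or_eq_gaussian with hle | ⟨c, hc⟩
  · linarith [min_le_left (1 / 2) (gap α)]
  exfalso
  have hF : IntegrableOn (flux f₀ f₁) (Ioi 0) := by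
    have i0 := g₀.integrableOn_integral (h := fun θ => (cos θ : ℂ))
      (fun θ => by rw [Complex.norm_real]; exact abs_cos_le_one θ) (by fun_prop)
    have i1 := g₁.integrableOn_integral (h := fun θ => (sin θ : ℂ))
      (fun θ => by rw [Complex.norm_real]; exact abs_sin_le_one θ) (by fun_prop)
    refine (i0.add i1).congr (Eventually.of_forall fun r => ?_)
    have c₀ := h₀.continuous
    have c₁ := h₁.continuous
    simp only [flux, Pi.add_apply]
    rw [intervalIntegral.integral_add (Continuous.intervalIntegrable (by fun_prop) _ _)
      (Continuous.intervalIntegrable (by fun_prop) _ _), mul_add]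
  have hF' := h.gaussL2.integrableOn_integral (fun θ => (norm_angular 0 θ).le)
    (continuous_angular 0)
  have hlim : Tendsto (flux f₀ f₁) (𝓝[>] 0) (𝓝 0) := by
    have := (hasDerivAt_flux h₀ h₁ 0).continuousAt.tendsto.mono_left
      (nhdsWithin_le_nhds (s := Ioi 0))
    simpa [flux] using this
  have h0 := integral_Ioi_zero_of_hasDerivAt (fun r _ => hasDerivAt_flux h₀ h₁ r) hF hF' hlim
  have hI := integral_mul_cexp_neg_mul_sq (b := 1 / 4) (by norm_num)
  have : ∫ r in Ioi (0 : ℝ), (r : ℂ) * mode 0 (fun ξ => pd 0 f₀ ξ + pd 1 f₁ ξ) r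
      = c * ∫ r in Ioi (0 : ℝ), (r : ℂ) * Complex.exp (-(1 / 4) * (r : ℂ) ^ 2) := by
    rw [← integral_const_mul]
    refine setIntegral_congr_fun measurableSet_Ioi fun r hr => ?_
    rw [hc r hr]
    push_cast
    ring_nf
  rw [this, hI] at h0
  have hc0 : c = 0 := by simpa using h0
  rw [hc r hr, hc0, zero_mul] at hm
  exact hm rfl

end ScalarBounds

section Calculus

variable {E : Type*} [NormedAddCommGroup E] [NormedSpace ℝ E]

theorem hasDerivAt_line {w : R2 → E} {ξ : R2} (hw : DifferentiableAt ℝ w ξ) (i : Fin 2) :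
    HasDerivAt (fun t : ℝ => w (ξ + t • e2 i)) (pd i w ξ) 0 :=
  hw.hasFDerivAt.hasLineDerivAt (e2 i)

theorem hasDerivAt_line_coord (ξ : R2) (i j : Fin 2) :
    HasDerivAt (fun t : ℝ => (ξ + t • e2 i) j) (e2 i j) 0 := by
  simp only [PiLp.add_apply, PiLp.smul_apply, smul_eq_mul]
  exact (hasDerivAt_mul_const (e2 i j)).const_add (ξ j)

theorem hasDerivAt_line_norm_sq (ξ : R2) (i : Fin 2) :
    HasDerivAt (fun t : ℝ => ‖ξ + t • e2 i‖ ^ 2) (2 * ξ i) 0 := by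
  simp only [norm_sq_eq]
  refine (((hasDerivAt_line_coord ξ i 0).pow 2).add
    ((hasDerivAt_line_coord ξ i 1).pow 2)).congr_deriv ?_
  fin_cases i <;> simp [e2]

theorem norm_sq_ne_zero {ξ : R2} (hξ : ξ ≠ 0) : ‖ξ‖ ^ 2 ≠ 0 := by
  simpa using hξ

theorem hasDerivAt_line_profile {ξ : R2} (hξ : ξ ≠ 0) (i : Fin 2) :
    HasDerivAt (fun t : ℝ => profile (‖ξ + t • e2 i‖ ^ 2)) (profile' (‖ξ‖ ^ 2) * (2 * ξ i)) 0 :=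
  HasDerivAt.comp_of_eq (0 : ℝ) (hasDerivAt_profile (norm_sq_ne_zero hξ))
    (hasDerivAt_line_norm_sq ξ i) (by simp)

theorem differentiableAt_profile' {a : ℝ} (ha : a ≠ 0) : DifferentiableAt ℝ profile' a := by
  unfold profile'
  fun_prop (disch := positivity)

theorem hasDerivAt_line_profile' {ξ : R2} (hξ : ξ ≠ 0) (i : Fin 2) :
    HasDerivAt (fun t : ℝ => profile' (‖ξ + t • e2 i‖ ^ 2))
      (deriv profile' (‖ξ‖ ^ 2) * (2 * ξ i)) 0 :=
  HasDerivAt.comp_of_eq (h₂ := profile') (0 : ℝ)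
    (differentiableAt_profile' (norm_sq_ne_zero hξ)).hasDerivAt
    (hasDerivAt_line_norm_sq ξ i) (by simp)

theorem pd_eq_of_hasDerivAt {w : R2 → E} {ξ : R2} (hw : DifferentiableAt ℝ w ξ) {i : Fin 2} {d : E}
    (h : HasDerivAt (fun t : ℝ => w (ξ + t • e2 i)) d 0) : pd i w ξ = d :=
  (hasDerivAt_line hw i).unique h

theorem pd_add {a b : R2 → E} (ha : ContDiff ℝ (⊤ : ℕ∞) a) (hb : ContDiff ℝ (⊤ : ℕ∞) b)
    (i : Fin 2) : pd i (fun ξ => a ξ + b ξ) = fun ξ => pd i a ξ + pd i b ξ := by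
  funext ξ
  have da := ha.differentiable (by simp) ξ
  have db := hb.differentiable (by simp) ξ
  exact pd_eq_of_hasDerivAt (da.add db) ((hasDerivAt_line da i).add (hasDerivAt_line db i))

theorem contDiff_coord_mul {a : R2 → ℂ} (ha : ContDiff ℝ (⊤ : ℕ∞) a) (j : Fin 2) :
    ContDiff ℝ (⊤ : ℕ∞) fun ξ => (ξ j : ℂ) * a ξ := by
  refine ContDiff.mul ?_ ha
  exact (Complex.ofRealCLM.comp (EuclideanSpace.proj j : R2 →L[ℝ] ℝ)).contDiff

theorem pd_coord_mul {a : R2 → ℂ} (ha : ContDiff ℝ (⊤ : ℕ∞) a) (i j : Fin 2) :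
    pd i (fun ξ => (ξ j : ℂ) * a ξ) = fun ξ => (e2 i j : ℂ) * a ξ + ξ j * pd i a ξ := by
  funext ξ
  have da := ha.differentiable (by simp) ξ
  refine pd_eq_of_hasDerivAt ((contDiff_coord_mul ha j).differentiable (by simp) ξ)
    (((hasDerivAt_line_coord ξ i j).ofReal_comp.mul (hasDerivAt_line da i)).congr_deriv ?_)
  simp

theorem contDiff_comp {f : R2 → C2} (hf : ContDiff ℝ (⊤ : ℕ∞) f) (j : Fin 2) :
    ContDiff ℝ (⊤ : ℕ∞) fun ξ => f ξ j :=
  ((EuclideanSpace.proj j : C2 →L[ℂ] ℂ).restrictScalars ℝ).contDiff.comp hf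

theorem pd_comp {f : R2 → C2} (hf : ContDiff ℝ (⊤ : ℕ∞) f) (i j : Fin 2) :
    pd i (fun ξ => f ξ j) = fun ξ => pd i f ξ j := by
  funext ξ
  have df := hf.differentiable (by simp) ξ
  refine pd_eq_of_hasDerivAt ((contDiff_comp hf j).differentiable (by simp) ξ) ?_
  exact ((EuclideanSpace.proj j : C2 →L[ℂ] ℂ).restrictScalars ℝ).hasFDerivAt.comp_hasDerivAt _
    (hasDerivAt_line df i)

theorem pd_comm' {w : R2 → E} (hw : ContDiff ℝ (⊤ : ℕ∞) w) : pd 1 (pd 0 w) = pd 0 (pd 1 w) :=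
  funext (pd_comm hw)

theorem GaussianDecay.pd {f : R2 → C2} (hf : ContDiff ℝ (⊤ : ℕ∞) f) (h : GaussianDecay f)
    (i : Fin 2) : GaussianDecay (pd i f) := by
  intro k l
  refine lt_of_le_of_lt (lintegral_mono fun ξ => ENNReal.ofReal_le_ofReal ?_) (h k (l + 1))
  gcongr
  have hd : ContDiffAt ℝ (⊤ : ℕ∞) (fderiv ℝ f) ξ :=
    (hf.fderiv_right (m := (⊤ : ℕ∞)) (by simp)).contDiffAt
  have h1 := (ContinuousLinearMap.apply ℝ C2 (e2 i)).norm_iteratedFDeriv_comp_left hd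
    (n := l) (by exact WithTop.coe_le_coe.2 le_top)
  rw [norm_iteratedFDeriv_fderiv] at h1
  refine h1.trans (mul_le_of_le_one_left (norm_nonneg _) ?_)
  refine ContinuousLinearMap.opNorm_le_bound _ zero_le_one fun L => ?_
  refine (L.le_opNorm (e2 i)).trans (le_of_eq ?_)
  simp [e2, mul_comm]

theorem GaussianDecay.gaussL2 {f : R2 → C2} (cf : Continuous f) (h : GaussianDecay f)
    (j : Fin 2) : GaussL2 fun ξ => f ξ j := by
  have cj : Continuous fun ξ => f ξ j := by fun_prop
  refine GaussL2.of_norm_sq_le cj (H := fun ξ => ‖f ξ‖ ^ 2) (fun k => ?_) fun ξ => ?_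
  · refine ⟨Continuous.aestronglyMeasurable (by fun_prop), ?_⟩
    rw [hasFiniteIntegral_iff_norm]
    refine lt_of_le_of_lt (lintegral_mono fun ξ => ENNReal.ofReal_le_ofReal ?_) (h k 0)
    rw [norm_of_nonneg (by positivity), norm_iteratedFDeriv_zero]
  · gcongr
    exact PiLp.norm_apply_le _ j

theorem GaussL2.pd_comp {f : R2 → C2} (hf : ContDiff ℝ (⊤ : ℕ∞) f) (h : GaussianDecay f)
    (i j : Fin 2) : GaussL2 (pd i fun ξ => f ξ j) := by
  rw [_root_.pd_comp hf]
  exact (h.pd hf i).gaussL2 (contDiff_pd hf i).continuous j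

theorem GaussL2.pd_pd_comp {f : R2 → C2} (hf : ContDiff ℝ (⊤ : ℕ∞) f) (h : GaussianDecay f)
    (i k j : Fin 2) : GaussL2 (pd i (pd k fun ξ => f ξ j)) := by
  rw [_root_.pd_comp hf]
  exact GaussL2.pd_comp (contDiff_pd hf k) (h.pd hf k) i j

theorem GaussL2.pd_pd_pd_comp {f : R2 → C2} (hf : ContDiff ℝ (⊤ : ℕ∞) f) (h : GaussianDecay f)
    (i k l j : Fin 2) : GaussL2 (pd i (pd k (pd l fun ξ => f ξ j))) := by
  rw [_root_.pd_comp hf]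
  exact GaussL2.pd_pd_comp (contDiff_pd hf l) (h.pd hf l) i k j

end Calculus

section System

theorem gvec_zero (ξ : R2) : gvec ξ 0 = -(profile (‖ξ‖ ^ 2) * ξ 1) := by
  simp only [gvec, profile, PiLp.smul_apply, v2_zero, smul_eq_mul, rpow_neg (norm_nonneg ξ),
    rpow_two]
  ring

theorem gvec_one (ξ : R2) : gvec ξ 1 = profile (‖ξ‖ ^ 2) * ξ 0 := by
  simp only [gvec, profile, PiLp.smul_apply, v2_one, smul_eq_mul, rpow_neg (norm_nonneg ξ),
    rpow_two]

theorem gvec_eq : gvec = fun ξ => (-(profile (‖ξ‖ ^ 2) * ξ 1)) • e2 0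
    + (profile (‖ξ‖ ^ 2) * ξ 0) • e2 1 := by
  funext ξ
  rw [← v2_eq, ← gvec_zero, ← gvec_one, v2_eta]

theorem differentiableAt_gvec {ξ : R2} (hξ : ξ ≠ 0) : DifferentiableAt ℝ gvec ξ := by
  have hp : DifferentiableAt ℝ (fun ξ : R2 => profile (‖ξ‖ ^ 2)) ξ :=
    DifferentiableAt.comp (f := fun ξ : R2 => ‖ξ‖ ^ 2) ξ
      (hasDerivAt_profile (norm_sq_ne_zero hξ)).differentiableAt
      (differentiableAt_fun_id.norm_sq ℝ)
  rw [gvec_eq]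
  fun_prop

theorem fderiv_gvec_zero {ξ : R2} (hξ : ξ ≠ 0) (i : Fin 2) : (fderiv ℝ gvec ξ (e2 i)) 0
    = -(profile' (‖ξ‖ ^ 2) * (2 * ξ i) * ξ 1 + profile (‖ξ‖ ^ 2) * e2 i 1) := by
  have h1 := (EuclideanSpace.proj 0 : R2 →L[ℝ] ℝ).hasFDerivAt.comp_hasDerivAt (0 : ℝ)
    (hasDerivAt_line (differentiableAt_gvec hξ) i)
  refine h1.unique (HasDerivAt.congr_of_eventuallyEq ?_
    (Eventually.of_forall fun t => gvec_zero (ξ + t • e2 i)))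
  refine ((hasDerivAt_line_profile hξ i).mul (hasDerivAt_line_coord ξ i 1)).neg.congr_deriv ?_
  simp

theorem fderiv_gvec_one {ξ : R2} (hξ : ξ ≠ 0) (i : Fin 2) : (fderiv ℝ gvec ξ (e2 i)) 1
    = profile' (‖ξ‖ ^ 2) * (2 * ξ i) * ξ 0 + profile (‖ξ‖ ^ 2) * e2 i 0 := by
  have h1 := (EuclideanSpace.proj 1 : R2 →L[ℝ] ℝ).hasFDerivAt.comp_hasDerivAt (0 : ℝ)
    (hasDerivAt_line (differentiableAt_gvec hξ) i)
  refine h1.unique (HasDerivAt.congr_of_eventuallyEq ?_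
    (Eventually.of_forall fun t => gvec_one (ξ + t • e2 i)))
  refine ((hasDerivAt_line_profile hξ i).mul (hasDerivAt_line_coord ξ i 0)).congr_deriv ?_
  simp

/-- Residual of one component of the eigenvalue equation, for the component `a`, the other
component `b`, the radial part `u`, and the coordinate index `k`. -/
def eigenResidual (α : ℝ) (lam s : ℂ) (k : Fin 2) (a b u : R2 → ℂ) (ξ : R2) : ℂ :=
  pd 0 (pd 0 a) ξ + pd 1 (pd 1 a) ξ + 1 / 2 * (ξ 0 * pd 0 a ξ + ξ 1 * pd 1 a ξ) + a ξ
    - α * ((profile (‖ξ‖ ^ 2) : ℝ) * (ξ 0 * pd 1 a ξ - ξ 1 * pd 0 a ξ)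
    + s * ((profile (‖ξ‖ ^ 2) : ℝ) * b ξ + 2 * ((profile' (‖ξ‖ ^ 2) : ℝ) * (u ξ * ξ k))))
    - lam * a ξ

theorem hasDerivAt_eigenResidual {α : ℝ} {lam s : ℂ} {k : Fin 2} {a b u : R2 → ℂ}
    (ha : ContDiff ℝ (⊤ : ℕ∞) a) (hb : ContDiff ℝ (⊤ : ℕ∞) b) (hu : ContDiff ℝ (⊤ : ℕ∞) u)
    {ξ : R2} (hξ : ξ ≠ 0) (i : Fin 2) :
    HasDerivAt (fun t : ℝ => eigenResidual α lam s k a b u (ξ + t • e2 i))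
      (pd i (pd 0 (pd 0 a)) ξ + pd i (pd 1 (pd 1 a)) ξ
        + 1 / 2 * ((e2 i 0 * pd 0 a ξ + ξ 0 * pd i (pd 0 a) ξ)
        + (e2 i 1 * pd 1 a ξ + ξ 1 * pd i (pd 1 a) ξ)) + pd i a ξ
        - α * (((profile' (‖ξ‖ ^ 2) * (2 * ξ i) : ℝ) * (ξ 0 * pd 1 a ξ - ξ 1 * pd 0 a ξ)
          + (profile (‖ξ‖ ^ 2) : ℝ) * ((e2 i 0 * pd 1 a ξ + ξ 0 * pd i (pd 1 a) ξ)
            - (e2 i 1 * pd 0 a ξ + ξ 1 * pd i (pd 0 a) ξ)))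
        + s * (((profile' (‖ξ‖ ^ 2) * (2 * ξ i) : ℝ) * b ξ + (profile (‖ξ‖ ^ 2) : ℝ) * pd i b ξ)
        + 2 * ((deriv profile' (‖ξ‖ ^ 2) * (2 * ξ i) : ℝ) * (u ξ * ξ k)
          + (profile' (‖ξ‖ ^ 2) : ℝ) * (pd i u ξ * ξ k + u ξ * e2 i k))))
        - lam * pd i a ξ) 0 := by
  have L : ∀ {w : R2 → ℂ}, ContDiff ℝ (⊤ : ℕ∞) w →
      HasDerivAt (fun t : ℝ => w (ξ + t • e2 i)) (pd i w ξ) 0 := fun hw =>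
    hasDerivAt_line (hw.differentiable (by simp) ξ) i
  have X := fun j => (hasDerivAt_line_coord ξ i j).ofReal_comp
  have P := (hasDerivAt_line_profile hξ i).ofReal_comp
  have P' := (hasDerivAt_line_profile' hξ i).ofReal_comp
  have a0 := contDiff_pd ha 0
  have a1 := contDiff_pd ha 1
  unfold eigenResidual
  refine ((((((L (contDiff_pd a0 0)).add (L (contDiff_pd a1 1))).add
    ((((X 0).mul (L a0)).add ((X 1).mul (L a1))).const_mul (1 / 2))).add (L ha)).sub
    (((P.mul (((X 0).mul (L a1)).sub ((X 1).mul (L a0)))).add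
    (((P.mul (L hb)).add ((P'.mul ((L hu).mul (X k))).const_mul 2)).const_mul s)).const_mul
    (α : ℂ))).sub ((L ha).const_mul lam)).congr_deriv ?_
  simp only [zero_smul, add_zero, Pi.mul_apply, Pi.sub_apply]

theorem eigenResidual_eq_zero {f : R2 → C2} {α : ℝ} {lam : ℂ} (hf : ContDiff ℝ (⊤ : ℕ∞) f)
    (h : ∀ ξ, FP f ξ - α • GammaOp f ξ = lam • f ξ) {ξ : R2} (hξ : ξ ≠ 0) :
    eigenResidual α lam 1 1 (fun ξ => f ξ 0) (fun ξ => f ξ 1)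
      (fun ξ => ξ 0 * f ξ 0 + ξ 1 * f ξ 1) ξ = 0 ∧
    eigenResidual α lam (-1) 0 (fun ξ => f ξ 1) (fun ξ => f ξ 0)
      (fun ξ => ξ 0 * f ξ 0 + ξ 1 * f ξ 1) ξ = 0 := by
  have hh := h ξ
  have d1 : fderiv ℝ f ξ ξ = (ξ 0) • pd 0 f ξ + (ξ 1) • pd 1 f ξ := by
    conv_lhs => rw [← v2_eta ξ, v2_eta ξ]
    rw [← fderiv_v2, v2_eta]
  have d2 : fderiv ℝ f ξ (gvec ξ) = (gvec ξ 0) • pd 0 f ξ + (gvec ξ 1) • pd 1 f ξ := by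
    rw [← fderiv_v2, v2_eta]
  have e00 : e2 0 0 = 1 := by simp [e2]
  have e01 : e2 0 1 = 0 := by simp [e2]
  have e10 : e2 1 0 = 0 := by simp [e2]
  have e11 : e2 1 1 = 1 := by simp [e2]
  have c0 : ∀ x y : ℂ, cv2 x y 0 = x := fun _ _ => rfl
  have c1 : ∀ x y : ℂ, cv2 x y 1 = y := fun _ _ => rfl
  have dd : ∀ i, fderiv ℝ (fun w => fderiv ℝ f w (e2 i)) ξ (e2 i) = pd i (pd i f) ξ := fun _ => rfl
  rw [FP, GammaOp, d1, d2, Fin.sum_univ_two, dd, dd] at hh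
  simp only [fderiv_gvec_zero hξ, fderiv_gvec_one hξ, gvec_zero, gvec_one, e00, e01, e10, e11] at hh
  have q0 := congrArg (fun v : C2 => v 0) hh
  have q1 := congrArg (fun v : C2 => v 1) hh
  simp only [PiLp.add_apply, PiLp.sub_apply, PiLp.smul_apply, c0, c1, Complex.real_smul,
    smul_eq_mul] at q0 q1
  simp only [eigenResidual, pd_comp hf, pd_comp (contDiff_pd hf _)]
  push_cast at q0 q1 ⊢
  constructor
  · linear_combination q0
  · linear_combination q1

end System

section Reduction

variable {α : ℝ} {lam : ℂ} {a b : R2 → ℂ}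

theorem e2_apply (i j : Fin 2) : e2 i j = if j = i then 1 else 0 := by
  simp [e2]

theorem contDiff_radial (ha : ContDiff ℝ (⊤ : ℕ∞) a) (hb : ContDiff ℝ (⊤ : ℕ∞) b) :
    ContDiff ℝ (⊤ : ℕ∞) fun ξ : R2 => ξ 0 * a ξ + ξ 1 * b ξ :=
  (contDiff_coord_mul ha 0).add (contDiff_coord_mul hb 1)

theorem pd_radial (ha : ContDiff ℝ (⊤ : ℕ∞) a) (hb : ContDiff ℝ (⊤ : ℕ∞) b) (i : Fin 2) :
    pd i (fun ξ => ξ 0 * a ξ + ξ 1 * b ξ) = fun ξ =>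
      ((e2 i 0 : ℂ) * a ξ + ξ 0 * pd i a ξ) + ((e2 i 1 : ℂ) * b ξ + ξ 1 * pd i b ξ) := by
  rw [pd_add (contDiff_coord_mul ha 0) (contDiff_coord_mul hb 1), pd_coord_mul ha, pd_coord_mul hb]

theorem pd_const_mul (ha : ContDiff ℝ (⊤ : ℕ∞) a) (c : ℂ) (i : Fin 2) :
    pd i (fun ξ => c * a ξ) = fun ξ => c * pd i a ξ := by
  funext ξ
  have da := ha.differentiable (by simp) ξ
  exact pd_eq_of_hasDerivAt (da.const_mul c) ((hasDerivAt_line da i).const_mul c)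

theorem contDiff_divergence (ha : ContDiff ℝ (⊤ : ℕ∞) a) (hb : ContDiff ℝ (⊤ : ℕ∞) b) :
    ContDiff ℝ (⊤ : ℕ∞) fun ξ => pd 0 a ξ + pd 1 b ξ :=
  (contDiff_pd ha 0).add (contDiff_pd hb 1)

theorem pd_pd_radial (ha : ContDiff ℝ (⊤ : ℕ∞) a) (hb : ContDiff ℝ (⊤ : ℕ∞) b) (i j : Fin 2) :
    pd i (pd j (fun ξ => ξ 0 * a ξ + ξ 1 * b ξ)) = fun ξ =>
      ((e2 j 0 : ℂ) * pd i a ξ + ((e2 i 0 : ℂ) * pd j a ξ + ξ 0 * pd i (pd j a) ξ))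
        + ((e2 j 1 : ℂ) * pd i b ξ + ((e2 i 1 : ℂ) * pd j b ξ + ξ 1 * pd i (pd j b) ξ)) := by
  have da := contDiff_pd ha j
  have db := contDiff_pd hb j
  have ca := fun c : ℂ => (contDiff_const (c := c)).mul ha
  have cb := fun c : ℂ => (contDiff_const (c := c)).mul hb
  rw [pd_radial ha hb, pd_add ((ca _).add (contDiff_coord_mul da 0))
    ((cb _).add (contDiff_coord_mul db 1)), pd_add (ca _) (contDiff_coord_mul da 0),
    pd_add (cb _) (contDiff_coord_mul db 1), pd_const_mul ha, pd_const_mul hb,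
    pd_coord_mul da, pd_coord_mul db]

/-- The componentwise form of the eigenvalue equation away from the origin. -/
def SystemEigen (α : ℝ) (lam : ℂ) (a b : R2 → ℂ) : Prop :=
  ∀ ξ ≠ 0, eigenResidual α lam 1 1 a b (fun ξ => ξ 0 * a ξ + ξ 1 * b ξ) ξ = 0 ∧
    eigenResidual α lam (-1) 0 b a (fun ξ => ξ 0 * a ξ + ξ 1 * b ξ) ξ = 0

theorem SystemEigen.divergence_eq (ha : ContDiff ℝ (⊤ : ℕ∞) a) (hb : ContDiff ℝ (⊤ : ℕ∞) b)
    (h : SystemEigen α lam a b) {ξ : R2} (hξ : ξ ≠ 0) {w : R2 → ℂ}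
    (hw : w = fun ξ => pd 0 a ξ + pd 1 b ξ) :
    pd 0 (pd 0 w) ξ + pd 1 (pd 1 w) ξ + 1 / 2 * (ξ 0 * pd 0 w ξ + ξ 1 * pd 1 w ξ)
      + 3 / 2 * w ξ - (α * profile (‖ξ‖ ^ 2) : ℝ) * (ξ 0 * pd 1 w ξ - ξ 1 * pd 0 w ξ)
      = lam * w ξ := by
  have hu := contDiff_radial ha hb
  have near : ∀ i, ∀ᶠ t : ℝ in 𝓝 0, ξ + t • e2 i ≠ 0 := fun i =>
    ContinuousAt.eventually_ne (g := fun t : ℝ => ξ + t • e2 i) (by fun_prop) (by simpa using hξ)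
  have q0 := (hasDerivAt_eigenResidual (α := α) (lam := lam) (s := 1) (k := 1)
    ha hb hu hξ 0).unique ((hasDerivAt_const (0 : ℝ) (0 : ℂ)).congr_of_eventuallyEq
    ((near 0).mono fun t ht => (h _ ht).1))
  have q1 := (hasDerivAt_eigenResidual (α := α) (lam := lam) (s := -1) (k := 0)
    hb ha hu hξ 1).unique ((hasDerivAt_const (0 : ℝ) (0 : ℂ)).congr_of_eventuallyEq
    ((near 1).mono fun t ht => (h _ ht).2))
  have a0 := contDiff_pd ha 0
  have a1 := contDiff_pd ha 1
  have b0 := contDiff_pd hb 0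
  have b1 := contDiff_pd hb 1
  subst hw
  simp only [pd_radial ha hb, e2_apply, pd_comm' ha, pd_comm' hb, pd_comm' a1, pd_comm' b0,
    pd_add a0 b1, pd_add (contDiff_pd a0 0) (contDiff_pd b1 0),
    pd_add (contDiff_pd a1 0) (contDiff_pd b1 1)] at q0 q1 ⊢
  norm_num at q0 q1 ⊢
  linear_combination q0 + q1

theorem SystemEigen.radial_eq (ha : ContDiff ℝ (⊤ : ℕ∞) a) (hb : ContDiff ℝ (⊤ : ℕ∞) b)
    (h : SystemEigen α lam a b) (hdiv : ∀ ξ, pd 0 a ξ + pd 1 b ξ = 0) {ξ : R2} (hξ : ξ ≠ 0)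
    {u : R2 → ℂ} (hu : u = fun ξ => ξ 0 * a ξ + ξ 1 * b ξ) :
    pd 0 (pd 0 u) ξ + pd 1 (pd 1 u) ξ + 1 / 2 * (ξ 0 * pd 0 u ξ + ξ 1 * pd 1 u ξ)
      + 3 / 2 * u ξ - (α * profile (‖ξ‖ ^ 2) : ℝ) * (ξ 0 * pd 1 u ξ - ξ 1 * pd 0 u ξ)
      = (lam + 1) * u ξ := by
  obtain ⟨q0, q1⟩ := h ξ hξ
  have hd := hdiv ξ
  subst hu
  simp only [pd_pd_radial ha hb]
  simp only [eigenResidual, pd_radial ha hb, e2_apply] at q0 q1 ⊢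
  norm_num at q0 q1 ⊢
  linear_combination ξ 0 * q0 + ξ 1 * q1 + 2 * hd

theorem rotation_eq_of_divergence_eq_zero (ha : ContDiff ℝ (⊤ : ℕ∞) a) (hb : ContDiff ℝ (⊤ : ℕ∞) b)
    (hdiv : ∀ ξ, pd 0 a ξ + pd 1 b ξ = 0) (hrad : ∀ ξ : R2, ξ 0 * a ξ + ξ 1 * b ξ = 0) (ξ : R2) :
    ξ 0 * pd 1 a ξ - ξ 1 * pd 0 a ξ = -b ξ ∧ ξ 0 * pd 1 b ξ - ξ 1 * pd 0 b ξ = a ξ := by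
  have hz : (fun ξ : R2 => ξ 0 * a ξ + ξ 1 * b ξ) = fun _ => 0 := funext hrad
  have hd := hdiv ξ
  have p0 := congrFun (pd_radial ha hb 0) ξ
  have p1 := congrFun (pd_radial ha hb 1) ξ
  have pz : ∀ i, pd i (fun _ : R2 => (0 : ℂ)) ξ = 0 := fun i => by simp [pd]
  rw [hz, pz] at p0 p1
  simp only [e2_apply] at p0 p1
  norm_num at p0 p1
  constructor
  · linear_combination -p1 - ξ 1 * hd
  · linear_combination p0 + ξ 0 * hd

theorem SystemEigen.re_le (ha : ContDiff ℝ (⊤ : ℕ∞) a) (hb : ContDiff ℝ (⊤ : ℕ∞) b)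
    (ga : GaussL2 a) (gb : GaussL2 b)
    (ga₁ : ∀ i, GaussL2 (pd i a)) (gb₁ : ∀ i, GaussL2 (pd i b))
    (ga₂ : ∀ i j, GaussL2 (pd i (pd j a))) (gb₂ : ∀ i j, GaussL2 (pd i (pd j b)))
    (ga₃ : ∀ i j k, GaussL2 (pd i (pd j (pd k a))))
    (gb₃ : ∀ i j k, GaussL2 (pd i (pd j (pd k b))))
    (hα : α ≠ 0) (h : SystemEigen α lam a b) (hne : ∃ ξ, a ξ ≠ 0 ∨ b ξ ≠ 0) :
    lam.re ≤ -min (1 / 2) (gap α) := by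
  by_cases hdiv : ∀ ξ, pd 0 a ξ + pd 1 b ξ = 0
  swap
  · push Not at hdiv
    refine ScalarEigen.re_le_of_divergence ha hb ga gb hα
      ⟨contDiff_divergence ha hb, (ga₁ 0).add (gb₁ 1), fun i => ?_, fun i j => ?_,
        fun ξ hξ => h.divergence_eq ha hb hξ rfl⟩ hdiv
    · rw [pd_add (contDiff_pd ha 0) (contDiff_pd hb 1)]
      exact (ga₂ i 0).add (gb₂ i 1)
    · rw [pd_add (contDiff_pd ha 0) (contDiff_pd hb 1),
        pd_add (contDiff_pd (contDiff_pd ha 0) j) (contDiff_pd (contDiff_pd hb 1) j)]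
      exact (ga₃ i j 0).add (gb₃ i j 1)
  suffices lam.re ≤ -(1 / 2) from this.trans (neg_le_neg (min_le_left _ _))
  by_cases hrad : ∀ ξ : R2, ξ 0 * a ξ + ξ 1 * b ξ = 0
  swap
  · push Not at hrad
    have key : ScalarEigen α (lam + 1) fun ξ : R2 => ξ 0 * a ξ + ξ 1 * b ξ := by
      refine ⟨contDiff_radial ha hb, (ga.coord_mul 0).add (gb.coord_mul 1), fun i => ?_,
        fun i j => ?_, fun ξ hξ => h.radial_eq ha hb hdiv hξ rfl⟩
      · rw [pd_radial ha hb]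
        exact ((ga.const_mul _).add ((ga₁ i).coord_mul 0)).add
          ((gb.const_mul _).add ((gb₁ i).coord_mul 1))
      · rw [pd_pd_radial ha hb]
        exact (((ga₁ i).const_mul _).add (((ga₁ j).const_mul _).add ((ga₂ i j).coord_mul 0))).add
          (((gb₁ i).const_mul _).add (((gb₁ j).const_mul _).add ((gb₂ i j).coord_mul 1)))
    have := key.re_le_half hrad
    simp only [Complex.add_re, Complex.one_re] at this
    linarith
  have rot := rotation_eq_of_divergence_eq_zero ha hb hdiv hrad
  suffices (lam + 1 / 2).re ≤ 0 by
    norm_num at this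
    linarith
  have ea : ScalarEigen 0 (lam + 1 / 2) a := by
    refine ⟨ha, ga, ga₁, ga₂, fun ξ hξ => ?_⟩
    have q := (h ξ hξ).1
    simp only [eigenResidual, hrad, (rot ξ).1] at q
    push_cast
    linear_combination q
  have eb : ScalarEigen 0 (lam + 1 / 2) b := by
    refine ⟨hb, gb, gb₁, gb₂, fun ξ hξ => ?_⟩
    have q := (h ξ hξ).2
    simp only [eigenResidual, hrad, (rot ξ).2] at q
    push_cast
    linear_combination q
  by_cases hb0 : ∃ ξ, b ξ ≠ 0
  · refine eb.re_nonpos_of_mode_zero hb0 fun r => ?_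
    have hna : ContDiff ℝ (⊤ : ℕ∞) fun ξ => -1 * a ξ := contDiff_const.mul ha
    rw [← mode_zero_rotation hna r]
    congr 1
    funext ξ
    rw [pd_const_mul ha, pd_const_mul ha]
    linear_combination (rot ξ).1
  · push Not at hb0
    obtain ⟨ξ, hξ⟩ := hne
    refine ea.re_nonpos_of_mode_zero ⟨ξ, hξ.resolve_right (not_not.2 (hb0 ξ))⟩ fun r => ?_
    rw [← mode_zero_rotation hb r]
    congr 1
    funext ξ
    exact (rot ξ).2.symm

end Reduction

end

theorem spectral_bound_Gamma (α : ℝ) (hα : α ≠ 0) :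
    ∃ μ : ℝ, 0 < μ ∧ μ ≤ 1/2 ∧
      ∀ (f : R2 → C2) (lam : ℂ),
        ContDiff ℝ (⊤ : ℕ∞) f → GaussianDecay f → (∃ ξ, f ξ ≠ 0) →
        (∀ ξ : R2, FP f ξ - α • GammaOp f ξ = lam • f ξ) →
        lam.re ≤ -μ := by
  refine ⟨min (1 / 2) (gap α), lt_min (by norm_num) gap_pos, min_le_left _ _, ?_⟩
  rintro f lam hf hd ⟨ξ, hξ⟩ h
  refine SystemEigen.re_le (contDiff_comp hf 0) (contDiff_comp hf 1)
    (hd.gaussL2 hf.continuous 0) (hd.gaussL2 hf.continuous 1)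
    (fun i => GaussL2.pd_comp hf hd i 0) (fun i => GaussL2.pd_comp hf hd i 1)
    (fun i j => GaussL2.pd_pd_comp hf hd i j 0) (fun i j => GaussL2.pd_pd_comp hf hd i j 1)
    (fun i j k => GaussL2.pd_pd_pd_comp hf hd i j k 0)
    (fun i j k => GaussL2.pd_pd_pd_comp hf hd i j k 1) hα
    (fun ξ hξ => eigenResidual_eq_zero hf h hξ) ⟨ξ, ?_⟩
  by_contra! hc
  refine hξ (PiLp.ext fun i => ?_)
  fin_cases i
  exacts [hc.1, hc.2]
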